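/- There exists an absolute constant c > 0 with the following property. Let f be a force with (c/(α^{5/2} β)) ‖f‖_{H¹_α} < β, let (U, N_U, P_U) be a classical stationary solution of the damped Navier–Stokes–Bardina equations with force f, and let (u, N, p) be any classical solution with force f and initial datum u₀. Then there exist a constant C > 0 (depending on α, β, ν, u₀, f, U) and a time t₀ ≥ 1 such that for all t ≥ t₀: sup_{x ∈ ℝ³} |u(t,x) − U(x)| ≤ C t^{−3/4}. -/

import Mathlib

open MeasureTheory Set

noncomputable section

abbrev V3 : Type := Fin 3 → ℝ

def pd (j : Fin 3) (g : V3 → Fin 3 → ℝ) : V3 → Fin 3 → ℝ :=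
  fun x => fderiv ℝ g x (Pi.single j 1)

def pdS (j : Fin 3) (g : V3 → ℝ) : V3 → ℝ :=
  fun x => fderiv ℝ g x (Pi.single j 1)

def L2sq (g : V3 → Fin 3 → ℝ) : ℝ := ∫ x : V3, ∑ i, (g x i)^2
def H1sq (g : V3 → Fin 3 → ℝ) : ℝ := ∫ x : V3, ∑ i, ∑ j, (pd j g x i)^2
def H2sq (g : V3 → Fin 3 → ℝ) : ℝ := ∫ x : V3, ∑ i, ∑ j, ∑ k, (pd k (pd j g) x i)^2
def H1aSq (α : ℝ) (g : V3 → Fin 3 → ℝ) : ℝ := L2sq g + α^2 * H1sq g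

def IsSchwartz {F : Type*} [NormedAddCommGroup F] [NormedSpace ℝ F] (g : V3 → F) : Prop :=
  ContDiff ℝ (⊤ : ℕ∞) g ∧ ∀ (k n : ℕ), ∃ C : ℝ, ∀ x : V3, ‖x‖ ^ k * ‖iteratedFDeriv ℝ n g x‖ ≤ C

def IsForce (f : V3 → Fin 3 → ℝ) : Prop :=
  IsSchwartz f ∧ ∀ x, (∑ j, pd j f x j) = 0

def SchwartzLocBdd {F : Type*} [NormedAddCommGroup F] [NormedSpace ℝ F]
    (g : ℝ → V3 → F) : Prop :=
  ContDiffOn ℝ (⊤ : ℕ∞) (fun q : ℝ × V3 => g q.1 q.2) (Set.Ici (0:ℝ) ×ˢ Set.univ) ∧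
  ∀ T > (0:ℝ), ∀ (k n : ℕ), ∃ C : ℝ, ∀ t ∈ Set.Icc (0:ℝ) T, ∀ x : V3,
    ‖x‖ ^ k * ‖iteratedFDeriv ℝ n (g t) x‖ ≤ C

structure ClassicalSolution (α β ν : ℝ) (u₀ f : V3 → Fin 3 → ℝ) where
  u : ℝ → V3 → Fin 3 → ℝ
  N : ℝ → V3 → Fin 3 → ℝ
  p : ℝ → V3 → ℝ
  reg_u : SchwartzLocBdd u
  reg_N : SchwartzLocBdd N
  reg_p : SchwartzLocBdd p
  divFree : ∀ t ≥ (0:ℝ), ∀ x, (∑ j, pd j (u t) x j) = 0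
  filter : ∀ t ≥ (0:ℝ), ∀ x i, -α^2 * (∑ j, pd j (pd j (N t)) x i) + N t x i
      = ∑ j, u t x j * pd j (u t) x i
  momentum : ∀ t ≥ (0:ℝ), ∀ x i,
      derivWithin (fun s => u s x i) (Set.Ici (0:ℝ)) t + N t x i
        - ν * (∑ j, pd j (pd j (u t)) x i) + pdS i (p t) x
      = f x i - β * u t x i
  init : ∀ x, u 0 x = u₀ x


structure StationarySolution (α β ν : ℝ) (f : V3 → Fin 3 → ℝ) where
  U : V3 → Fin 3 → ℝ
  N : V3 → Fin 3 → ℝ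
  P : V3 → ℝ
  schwartz_U : IsSchwartz U
  schwartz_N : IsSchwartz N
  schwartz_P : IsSchwartz P
  divFree : ∀ x, (∑ j, pd j U x j) = 0
  filter : ∀ x i, -α^2 * (∑ j, pd j (pd j N) x i) + N x i = ∑ j, U x j * pd j U x i
  momentum : ∀ x i, -ν * (∑ j, pd j (pd j U) x i) + N x i + pdS i P x
      = f x i - β * U x i

/-! ## Calculus of real Schwartz functions on `V3` -/

/-- Real-valued Schwartz functions. -/
abbrev SR : Type := SchwartzMap V3 ℝ

open scoped LineDeriv in
/-- The `j`-th partial derivative on Schwartz functions. -/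
def dS (j : Fin 3) : SR →L[ℝ] SR := LineDeriv.lineDerivOpCLM ℝ SR (Pi.single j 1 : V3)

lemma dS_apply (j : Fin 3) (g : SR) (x : V3) : dS j g x = fderiv ℝ g x (Pi.single j 1) := rfl

/-- The Laplacian on Schwartz functions. -/
def lap : SR →L[ℝ] SR := ∑ j, (dS j).comp (dS j)

lemma lap_apply (g : SR) : lap g = ∑ j, dS j (dS j g) := by
  simp [lap]

/-- The pointwise product of Schwartz functions. -/
def mulS (f : SR) : SR →L[ℝ] SR := SchwartzMap.pairing (ContinuousLinearMap.mul ℝ ℝ) f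

@[simp] lemma mulS_apply (f g : SR) (x : V3) : mulS f g x = f x * g x := rfl

lemma mulS_comm (f g : SR) : mulS f g = mulS g f := by
  ext x; simp [mul_comm]

lemma dS_comm (j k : Fin 3) (g : SR) : dS j (dS k g) = dS k (dS j g) := by
  ext x
  have hd : DifferentiableAt ℝ (fderiv ℝ g) x :=
    ((g.smooth 2).fderiv_right (m := 1) (by norm_num)).differentiable (by norm_num) x
  have h1 : ∀ v w : V3, fderiv ℝ (fun y => fderiv ℝ g y v) x w = fderiv ℝ (fderiv ℝ g) x w v := by
    intro v w
    rw [fderiv_clm_apply hd (differentiableAt_const v)]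
    simp
  have hs : IsSymmSndFDerivAt ℝ g x :=
    (g.smooth 2).contDiffAt.isSymmSndFDerivAt (by simp)
  change fderiv ℝ (fun y => fderiv ℝ g y _) x _ = fderiv ℝ (fun y => fderiv ℝ g y _) x _
  rw [h1, h1]
  exact hs _ _

lemma dS_mulS (j : Fin 3) (f g : SR) : dS j (mulS f g) = mulS (dS j f) g + mulS f (dS j g) := by
  ext x
  change fderiv ℝ (fun y => f y * g y) x _ = _
  rw [fderiv_fun_mul f.differentiableAt g.differentiableAt]
  simp [dS_apply]
  ring

lemma dS_lap (j : Fin 3) (g : SR) : dS j (lap g) = lap (dS j g) := by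
  simp only [lap_apply, map_sum]
  refine Finset.sum_congr rfl fun k _ => ?_
  rw [dS_comm j k, dS_comm j k]

/-- The `L²` pairing. -/
def ip (f g : SR) : ℝ := ∫ x, f x * g x

lemma integrable_mul (f g : SR) : Integrable (fun x => f x * g x) := (mulS f g).integrable

lemma ip_comm (f g : SR) : ip f g = ip g f := by
  simp [ip, mul_comm]

lemma ip_add_right (f g h : SR) : ip f (g + h) = ip f g + ip f h := by
  simp only [ip, ← integral_add (integrable_mul f g) (integrable_mul f h)]
  simp [mul_add]

lemma ip_smul_right (c : ℝ) (f g : SR) : ip f (c • g) = c * ip f g := by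
  simp only [ip, ← integral_const_mul]
  congr 1; ext x; simp; ring

/-- The `L²` pairing as a linear map in its second argument. -/
def ipL (f : SR) : SR →ₗ[ℝ] ℝ where
  toFun := ip f
  map_add' := ip_add_right f
  map_smul' c g := ip_smul_right c f g

lemma ip_sub_right (f g h : SR) : ip f (g - h) = ip f g - ip f h := map_sub (ipL f) g h
lemma ip_neg_right (f g : SR) : ip f (-g) = -ip f g := map_neg (ipL f) g
lemma ip_sum_right {ι : Type*} (s : Finset ι) (f : SR) (g : ι → SR) :
    ip f (∑ i ∈ s, g i) = ∑ i ∈ s, ip f (g i) := map_sum (ipL f) g s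
lemma ip_zero_right (f : SR) : ip f 0 = 0 := map_zero (ipL f)

lemma ip_add_left (f g h : SR) : ip (f + g) h = ip f h + ip g h := by
  simp only [ip_comm _ h, ip_add_right]
lemma ip_sub_left (f g h : SR) : ip (f - g) h = ip f h - ip g h := by
  simp only [ip_comm _ h, ip_sub_right]
lemma ip_neg_left (f g : SR) : ip (-f) g = -ip f g := by
  simp only [ip_comm _ g, ip_neg_right]
lemma ip_smul_left (c : ℝ) (f g : SR) : ip (c • f) g = c * ip f g := by
  simp only [ip_comm _ g, ip_smul_right]
lemma ip_sum_left {ι : Type*} (s : Finset ι) (f : SR) (g : ι → SR) :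
    ip (∑ i ∈ s, g i) f = ∑ i ∈ s, ip (g i) f := by
  simp only [ip_comm _ f, ip_sum_right]

lemma ip_dS (j : Fin 3) (f g : SR) : ip f (dS j g) = -ip (dS j f) g :=
  SchwartzMap.integral_mul_lineDerivOp_right_eq_neg_left f g (Pi.single j 1)

lemma ip_mulS (f g h : SR) : ip (mulS f g) h = ip f (mulS g h) := by
  simp [ip, mul_assoc]

lemma ip_lap_right (f g : SR) : ip f (lap g) = -∑ j, ip (dS j f) (dS j g) := by
  simp [lap_apply, ip_sum_right, ip_dS]

lemma ip_lap (f g : SR) : ip f (lap g) = ip (lap f) g := by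
  rw [ip_lap_right, ip_comm (lap f), ip_lap_right]
  simp [ip_comm]

lemma ip_self_nonneg (f : SR) : 0 ≤ ip f f := integral_nonneg fun x => mul_self_nonneg (f x)

/-- The `L²` norm. -/
def nrm (f : SR) : ℝ := √(ip f f)

lemma nrm_nonneg (f : SR) : 0 ≤ nrm f := Real.sqrt_nonneg _

lemma nrm_sq (f : SR) : nrm f ^ 2 = ip f f := Real.sq_sqrt (ip_self_nonneg f)

lemma abs_ip_le (f g : SR) : |ip f g| ≤ nrm f * nrm g := by
  rw [nrm, nrm, ← Real.sqrt_mul (ip_self_nonneg f), ← Real.sqrt_sq_eq_abs]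
  apply Real.sqrt_le_sqrt
  have h : ∀ t : ℝ, 0 ≤ ip g g * (t * t) + (2 * ip f g) * t + ip f f := by
    intro t
    have := ip_self_nonneg (f + t • g)
    simp only [ip_add_left, ip_add_right, ip_smul_left, ip_smul_right, ip_comm g f] at this
    linarith
  have := discrim_le_zero h
  unfold discrim at this
  nlinarith

lemma nrm_add_le (f g : SR) : nrm (f + g) ≤ nrm f + nrm g := by
  have h := abs_ip_le f g
  refine Real.sqrt_le_iff.2 ⟨add_nonneg (nrm_nonneg f) (nrm_nonneg g), ?_⟩
  simp only [ip_add_left, ip_add_right, ip_comm g f]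
  nlinarith [nrm_sq f, nrm_sq g, le_abs_self (ip f g)]

lemma nrm_mulS_le {M : ℝ} (hM : 0 ≤ M) (f g : SR) (h : ∀ x, |f x| ≤ M) :
    nrm (mulS f g) ≤ M * nrm g := by
  refine Real.sqrt_le_iff.2 ⟨mul_nonneg hM (nrm_nonneg g), ?_⟩
  rw [mul_pow, nrm_sq, ip, ip, ← integral_const_mul]
  refine integral_mono (integrable_mul _ _) ((integrable_mul _ _).const_mul _) fun x => ?_
  have : f x ^ 2 ≤ M ^ 2 := sq_le_sq.2 (by rw [abs_of_nonneg hM]; exact h x)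
  simp only [mulS_apply]
  nlinarith [mul_le_mul_of_nonneg_right this (mul_self_nonneg (g x))]

lemma nrm_lap_le (f : SR) : nrm (lap f) ≤ ∑ j, nrm (dS j (dS j f)) := by
  rw [lap_apply, Fin.sum_univ_three, Fin.sum_univ_three]
  exact (nrm_add_le _ _).trans (add_le_add_left (nrm_add_le _ _) _)

/-- A drift with zero divergence is skew for the `L²` pairing. -/
lemma transport_eq_zero (u : Fin 3 → SR) (hu : ∑ j, dS j (u j) = 0) (g : SR) :
    ∑ j, ip (mulS (u j) (dS j g)) g = 0 := by
  have h : ∀ j, ip (mulS (u j) (dS j g)) g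
      = -ip (dS j (u j)) (mulS g g) - ip (mulS (u j) (dS j g)) g := by
    intro j
    have h1 : ip (mulS (u j) (dS j g)) g = ip (mulS (u j) g) (dS j g) := by
      rw [ip_mulS, ip_mulS, mulS_comm]
    have h2 : ip (mulS (dS j (u j)) g) g = ip (dS j (u j)) (mulS g g) := ip_mulS _ _ _
    have h0 := ip_dS j (mulS (u j) g) g
    rw [dS_mulS, ip_add_left, h2, ← h1] at h0
    linarith
  have h3 : ∑ j, ip (dS j (u j)) (mulS g g) = 0 := by
    rw [← ip_sum_left, hu, ip_comm, ip_zero_right]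
  have h4 := Finset.sum_congr rfl fun j (_ : j ∈ Finset.univ) => h j
  rw [Finset.sum_sub_distrib, Finset.sum_neg_distrib, h3] at h4
  linarith

/-! ## The energy identity -/

/-- The inner product of `H¹_α`. -/
def hip (α : ℝ) (a b : Fin 3 → SR) : ℝ :=
  ∑ i, (ip (a i) (b i) + α ^ 2 * ∑ j, ip (dS j (a i)) (dS j (b i)))

lemma hip_eq_left (α : ℝ) (a b : Fin 3 → SR) :
    hip α a b = ∑ i, ip (a i - α ^ 2 • lap (a i)) (b i) := by
  refine Finset.sum_congr rfl fun i _ => ?_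
  rw [ip_sub_left, ip_smul_left, ← ip_lap, ip_lap_right]
  ring

lemma hip_comm (α : ℝ) (a b : Fin 3 → SR) : hip α a b = hip α b a := by
  simp only [hip, ip_comm]

lemma hip_add_left (α : ℝ) (a b d : Fin 3 → SR) :
    hip α (fun i => a i + b i) d = hip α a d + hip α b d := by
  simp only [hip_eq_left, ← Finset.sum_add_distrib, map_add, ← ip_add_left, smul_add]
  refine Finset.sum_congr rfl fun i _ => ?_
  congr 1; abel

lemma hip_smul_left (α c : ℝ) (a d : Fin 3 → SR) :
    hip α (fun i => c • a i) d = c * hip α a d := by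
  simp only [hip_eq_left, Finset.mul_sum, map_smul, ← ip_smul_left, smul_sub]
  refine Finset.sum_congr rfl fun i _ => ?_
  rw [smul_comm]

lemma hip_self_nonneg (α : ℝ) (a : Fin 3 → SR) : 0 ≤ hip α a a :=
  Finset.sum_nonneg fun _ _ => add_nonneg (ip_self_nonneg _)
    (mul_nonneg (sq_nonneg _) (Finset.sum_nonneg fun _ _ => ip_self_nonneg _))

lemma abs_hip_le (α : ℝ) (a b : Fin 3 → SR) :
    |hip α a b| ≤ √(hip α a a) * √(hip α b b) := by
  rw [← Real.sqrt_mul (hip_self_nonneg α a), ← Real.sqrt_sq_eq_abs]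
  apply Real.sqrt_le_sqrt
  have h : ∀ t : ℝ, 0 ≤ hip α b b * (t * t) + (2 * hip α a b) * t + hip α a a := by
    intro t
    have := hip_self_nonneg α (fun i => a i + t • b i)
    rw [hip_add_left, hip_smul_left, hip_comm α a, hip_comm α b, hip_add_left, hip_add_left,
      hip_smul_left, hip_smul_left, hip_comm α b a] at this
    linarith
  have := discrim_le_zero h
  unfold discrim at this
  nlinarith

lemma hip_lap_nonpos (α : ℝ) (a : Fin 3 → SR) : hip α (fun i => lap (a i)) a ≤ 0 := by
  refine Finset.sum_nonpos fun i _ => ?_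
  have h : ∀ g : SR, ip (lap g) g ≤ 0 := fun g => by
    rw [ip_comm, ip_lap_right]
    exact neg_nonpos.2 (Finset.sum_nonneg fun _ _ => ip_self_nonneg _)
  refine add_nonpos (h _) (mul_nonpos_of_nonneg_of_nonpos (sq_nonneg _)
    (Finset.sum_nonpos fun j _ => ?_))
  rw [dS_lap]
  exact h _

lemma hip_grad (α : ℝ) (a : Fin 3 → SR) (ha : ∑ j, dS j (a j) = 0) (q : SR) :
    hip α (fun i => dS i q) a = 0 := by
  rw [hip_eq_left]
  have h : ∀ i, ip (dS i q - α ^ 2 • lap (dS i q)) (a i)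
      = -ip (q - α ^ 2 • lap q) (dS i (a i)) := by
    intro i
    rw [ip_dS, neg_neg, map_sub, map_smul, dS_lap]
  rw [Finset.sum_congr rfl fun i _ => h i, Finset.sum_neg_distrib, ← ip_sum_right, ha,
    ip_zero_right, neg_zero]

/-- The `H¹_α` energy inequality for the damped filtered linear system. -/
lemma hip_rhs_le {α β ν : ℝ} (hν : 0 < ν) (a M B r : Fin 3 → SR) (q : SR)
    (ha : ∑ j, dS j (a j) = 0) (hM : ∀ i, M i - α ^ 2 • lap (M i) = B i)
    (hr : ∀ i, r i = ν • lap (a i) + (-1 : ℝ) • M i + (-1 : ℝ) • dS i q + (-β) • a i) :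
    hip α r a ≤ -β * hip α a a - ∑ i, ip (B i) (a i) := by
  have : r = fun i => ν • lap (a i) + (-1 : ℝ) • M i + (-1 : ℝ) • dS i q + (-β) • a i :=
    funext hr
  rw [this, hip_add_left, hip_add_left, hip_add_left, hip_smul_left, hip_smul_left, hip_smul_left,
    hip_smul_left, hip_grad α a ha, hip_eq_left α M]
  simp only [hM]
  have := mul_nonpos_of_nonneg_of_nonpos hν.le (hip_lap_nonpos α a)
  linarith

/-! ## Sobolev inequalities -/

section SupBound

open scoped FourierTransform LineDeriv Laplacian

/-- Euclidean three-space. -/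
local notation "E3" => EuclideanSpace ℝ (Fin 3)

lemma fourier_sub_laplacian_apply (f : SchwartzMap E3 ℂ) (ξ : E3) :
    𝓕 (f - ((1 / (2 * Real.pi) ^ 2 : ℝ) : ℂ) • Δ f) ξ = ((1 + ‖ξ‖ ^ 2 : ℝ) : ℂ) * 𝓕 f ξ := by
  have hl : 𝓕 (Δ f) ξ = (-((2 * Real.pi) ^ 2 * ‖ξ‖ ^ 2 : ℝ) : ℂ) * 𝓕 f ξ := by
    have ht : Function.HasTemperateGrowth (fun y : E3 => ((‖y‖ ^ 2 : ℝ) : ℝ)) := by fun_prop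
    rw [SchwartzMap.laplacian_eq_fourierMultiplierCLM, SchwartzMap.fourierMultiplierCLM_apply,
      ← FourierTransform.fourierInv_smul, FourierTransform.fourier_fourierInv_eq]
    simp only [_root_.smul_apply]
    have he := SchwartzMap.smulLeftCLM_apply_apply (F := ℂ) ht (𝓕 f) ξ
    change -(2 * Real.pi) ^ 2 • ((SchwartzMap.smulLeftCLM ℂ fun x : E3 => ‖x‖ ^ 2) (𝓕 f)) ξ = _
    rw [he]
    simp
    ring
  rw [sub_eq_add_neg, FourierTransform.fourier_add, FourierTransform.fourier_neg,
    FourierTransform.fourier_smul]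
  simp only [_root_.add_apply, _root_.neg_apply, _root_.smul_apply, hl]
  have : (Real.pi : ℂ) ≠ 0 := by exact_mod_cast Real.pi_ne_zero
  simp
  field_simp

lemma norm_le_of_fourier : ∃ K : ℝ, 0 < K ∧ ∀ (f : SchwartzMap E3 ℂ) (x : E3),
    ‖f x‖ ^ 2 ≤ K * ∫ y, ‖(f - ((1 / (2 * Real.pi) ^ 2 : ℝ) : ℂ) • Δ f) y‖ ^ 2 := by
  have hw : Integrable (fun ξ : E3 => ((1 + ‖ξ‖ ^ 2)⁻¹) ^ 2) := by
    have := integrable_rpow_neg_one_add_norm_sq (E := E3) (μ := volume) (r := 4) (by simp; norm_num)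
    refine this.congr (Filter.Eventually.of_forall fun ξ => ?_)
    have h : (0:ℝ) < 1 + ‖ξ‖ ^ 2 := by positivity
    simp only
    rw [show (-4 / 2 : ℝ) = -((2:ℕ) : ℝ) by norm_num, Real.rpow_neg h.le, Real.rpow_natCast, inv_pow]
  have hwn : 0 ≤ ∫ ξ : E3, ((1 + ‖ξ‖ ^ 2)⁻¹) ^ 2 := integral_nonneg fun _ => by positivity
  refine ⟨(∫ ξ : E3, ((1 + ‖ξ‖ ^ 2)⁻¹) ^ 2) + 1, by positivity, fun f x => ?_⟩
  set h := f - ((1 / (2 * Real.pi) ^ 2 : ℝ) : ℂ) • Δ f with hh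
  have h1 : ‖f x‖ ≤ ∫ ξ, ‖𝓕 f ξ‖ := by
    conv_lhs => rw [← FourierTransform.fourierInv_fourier_eq (F := SchwartzMap E3 ℂ) f]
    rw [SchwartzMap.fourierInv_coe, Real.fourierInv_eq]
    refine (norm_integral_le_integral_norm _).trans (le_of_eq ?_)
    simp
  have h2 : ∀ ξ, ‖𝓕 f ξ‖ = (1 + ‖ξ‖ ^ 2)⁻¹ * ‖𝓕 h ξ‖ := by
    intro ξ
    have hp : (0:ℝ) < 1 + ‖ξ‖ ^ 2 := by positivity
    rw [hh, fourier_sub_laplacian_apply, norm_mul, Complex.norm_real, Real.norm_of_nonneg hp.le]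
    field_simp
  have hm : MemLp (fun ξ => ‖𝓕 h ξ‖) 2 (volume : Measure E3) := ((𝓕 h).memLp 2).norm
  have hm' : MemLp (fun ξ : E3 => (1 + ‖ξ‖ ^ 2)⁻¹) 2 (volume : Measure E3) := by
    rw [memLp_two_iff_integrable_sq]
    · exact hw
    · refine Continuous.aestronglyMeasurable ?_
      exact Continuous.inv₀ (by fun_prop) fun ξ => by positivity
  have h3 := integral_mul_le_Lp_mul_Lq_of_nonneg (μ := (volume : Measure E3)) (p := 2) (q := 2) 
    (by constructor <;> norm_num) (f := fun ξ : E3 => (1 + ‖ξ‖ ^ 2)⁻¹) (g := fun ξ => ‖𝓕 h ξ‖)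
    (Filter.Eventually.of_forall fun _ => by positivity)
    (Filter.Eventually.of_forall fun _ => by positivity) (by simpa using hm') (by simpa using hm)
  have h4 : ∫ ξ, ‖𝓕 h ξ‖ ^ 2 = ∫ y, ‖h y‖ ^ 2 := SchwartzMap.integral_norm_sq_fourier h
  have hB : 0 ≤ ∫ y, ‖h y‖ ^ 2 := integral_nonneg fun _ => by positivity
  simp only [Real.rpow_two, h4, ← Real.sqrt_eq_rpow] at h3
  have h5 : ‖f x‖ ≤ _ := (h1.trans_eq (by simp only [h2])).trans h3
  calc ‖f x‖ ^ 2 ≤ (√(∫ ξ : E3, ((1 + ‖ξ‖ ^ 2)⁻¹) ^ 2) * √(∫ y, ‖h y‖ ^ 2)) ^ 2 := by gcongr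
    _ = (∫ ξ : E3, ((1 + ‖ξ‖ ^ 2)⁻¹) ^ 2) * ∫ y, ‖h y‖ ^ 2 := by
      rw [mul_pow, Real.sq_sqrt hwn, Real.sq_sqrt hB]
    _ ≤ _ := by nlinarith

/-- Transport of a real Schwartz function on `V3` to a complex one on Euclidean space. -/
def toE (g : SR) : SchwartzMap E3 ℂ :=
  SchwartzMap.postcompCLM Complex.ofRealCLM
    (SchwartzMap.compCLMOfContinuousLinearEquiv ℝ (EuclideanSpace.equiv (Fin 3) ℝ) g)

lemma toE_apply (g : SR) (x : E3) : toE g x = (g (WithLp.ofLp x) : ℂ) := rfl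

lemma lineDeriv_toE (g : SR) (j : Fin 3) :
    ∂_{EuclideanSpace.basisFun (Fin 3) ℝ j} (toE g) = toE (dS j g) := by
  ext x
  rw [SchwartzMap.lineDerivOp_apply_eq_fderiv, toE_apply, dS_apply]
  have h : HasFDerivAt (toE g) (Complex.ofRealCLM.comp
      ((fderiv ℝ g (WithLp.ofLp x)).comp (EuclideanSpace.equiv (Fin 3) ℝ : E3 →L[ℝ] V3))) x :=
    Complex.ofRealCLM.hasFDerivAt.comp x
      ((g.differentiableAt (x := WithLp.ofLp x)).hasFDerivAt.comp x
        (EuclideanSpace.equiv (Fin 3) ℝ : E3 →L[ℝ] V3).hasFDerivAt)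
  rw [h.fderiv]
  simp
  rfl

lemma laplacian_toE (g : SR) : Δ (toE g) = toE (lap g) := by
  rw [SchwartzMap.laplacian_eq_sum (EuclideanSpace.basisFun (Fin 3) ℝ)]
  simp only [lineDeriv_toE, lap_apply]
  ext x
  simp [toE_apply]

lemma exists_abs_le_nrm_add_nrm_lap : ∃ K : ℝ, 0 < K ∧ ∀ (g : SR) (x : V3),
    |g x| ≤ K * (nrm g + nrm (lap g)) := by
  obtain ⟨K, hK, h⟩ := norm_le_of_fourier
  set c : ℝ := 1 / (2 * Real.pi) ^ 2 with hc
  have hc0 : 0 ≤ c := by positivity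
  refine ⟨√K * (1 + c), by positivity, fun g x => ?_⟩
  have h1 := h (toE g) (WithLp.toLp 2 x)
  have h2 : ∫ y, ‖(toE g - ((c : ℝ) : ℂ) • Δ (toE g)) y‖ ^ 2
      = ip (g - c • lap g) (g - c • lap g) := by
    rw [ip, ← (PiLp.volume_preserving_ofLp (Fin 3)).integral_comp
      (MeasurableEquiv.toLp 2 V3).symm.measurableEmbedding]
    refine integral_congr_ae (Filter.Eventually.of_forall fun y => ?_)
    have : (toE g - ((c : ℝ) : ℂ) • Δ (toE g)) y
        = (((g - c • lap g) (WithLp.ofLp y) : ℝ) : ℂ) := by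
      rw [laplacian_toE]
      simp [toE_apply]
    simp only [this, Complex.norm_real, Real.norm_eq_abs, sq_abs]
    rw [sq]
  rw [h2, toE_apply, Complex.norm_real, Real.norm_eq_abs] at h1
  have h3 : |g x| ≤ √K * nrm (g - c • lap g) := by
    rw [nrm, ← Real.sqrt_mul hK.le]
    exact Real.le_sqrt_of_sq_le h1
  have h4 : nrm (g - c • lap g) ≤ nrm g + c * nrm (lap g) := by
    have h5 := nrm_add_le g (-(c • lap g))
    have h6 : nrm (-(c • lap g)) = c * nrm (lap g) := by
      rw [nrm, ip_neg_left, ip_neg_right, ip_smul_left, ip_smul_right, neg_neg, ← mul_assoc,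
        Real.sqrt_mul (mul_self_nonneg c), Real.sqrt_mul_self hc0, nrm]
    rwa [h6, ← sub_eq_add_neg] at h5
  have hn := nrm_nonneg g
  have hn' := nrm_nonneg (lap g)
  calc |g x| ≤ √K * (nrm g + c * nrm (lap g)) := h3.trans (by gcongr)
    _ ≤ √K * ((1 + c) * (nrm g + nrm (lap g))) := by
      gcongr
      nlinarith [mul_nonneg hc0 hn]
    _ = _ := by ring

end SupBound

lemma eLpNorm_six_le : ∃ K : NNReal, ∀ g : SR,
    eLpNorm g 6 volume ≤ K * eLpNorm (fderiv ℝ g) 2 volume := by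
  obtain ⟨K, hK⟩ : ∃ K : NNReal, K = SNormLESNormFDerivOfEqConst ℝ (volume : Measure V3) 2 :=
    ⟨_, rfl⟩
  refine ⟨K, fun g => ?_⟩
  let φ : ContDiffBump (0 : V3) := ⟨1, 2, by norm_num, by norm_num⟩
  have hφ : ContDiff ℝ 1 φ := φ.contDiff
  obtain ⟨M, hM⟩ : ∃ M, ∀ x, ‖fderiv ℝ φ x‖ ≤ M :=
    (φ.hasCompactSupport.fderiv ℝ).exists_bound_of_continuous (hφ.continuous_fderiv (by norm_num))
  have hM0 : 0 ≤ M := (norm_nonneg _).trans (hM 0)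
  let u : ℕ → V3 → ℝ := fun n x => φ ((1 / ((n : ℝ) + 1)) • x) * g x
  have hu : ∀ n, ContDiff ℝ 1 (u n) := fun n =>
    (hφ.comp (contDiff_const_smul _)).mul (g.smooth 1)
  have hcs : ∀ n, HasCompactSupport (u n) := fun n =>
    (φ.hasCompactSupport.comp_smul (by positivity)).mul_right
  have hpt : ∀ n x, ‖fderiv ℝ (u n) x‖ ≤ ‖fderiv ℝ g x‖ + (1 / ((n : ℝ) + 1)) * (M * ‖g x‖) := by
    intro n x
    have hr : (0:ℝ) < 1 / ((n : ℝ) + 1) := by positivity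
    have h1 : HasFDerivAt (fun x : V3 => φ ((1 / ((n : ℝ) + 1)) • x))
        ((fderiv ℝ φ ((1 / ((n : ℝ) + 1)) • x)).comp
          ((1 / ((n : ℝ) + 1)) • ContinuousLinearMap.id ℝ V3)) x :=
      ((hφ.differentiable (by norm_num)) _).hasFDerivAt.comp x
        ((1 / ((n : ℝ) + 1)) • ContinuousLinearMap.id ℝ V3).hasFDerivAt
    have h2 := (h1.mul g.differentiableAt.hasFDerivAt).fderiv
    refine (congrArg norm h2).le.trans ?_
    refine (norm_add_le _ _).trans (add_le_add ?_ ?_)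
    · rw [norm_smul, Real.norm_of_nonneg φ.nonneg]
      exact mul_le_of_le_one_left (norm_nonneg _) φ.le_one
    · rw [norm_smul, ContinuousLinearMap.comp_smul, norm_smul, ContinuousLinearMap.comp_id,
        Real.norm_of_nonneg hr.le]
      have := hM ((1 / ((n : ℝ) + 1)) • x)
      calc ‖g x‖ * (1 / ((n : ℝ) + 1) * ‖fderiv ℝ φ ((1 / ((n : ℝ) + 1)) • x)‖) 
          ≤ ‖g x‖ * (1 / ((n : ℝ) + 1) * M) := by gcongr
        _ = _ := by ring
  have hb : ∀ n, eLpNorm (u n) 6 volume ≤ K * (eLpNorm (fderiv ℝ g) 2 volume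
      + ENNReal.ofReal ((1 / ((n : ℝ) + 1)) * M) * eLpNorm g 2 volume) := by
    intro n
    have h1 := eLpNorm_le_eLpNorm_fderiv_of_eq (volume : Measure V3) (hu n) (hcs n)
      (p := 2) (p' := 6) (by norm_num) (by simp) (by simp; norm_num)
    have h1 : eLpNorm (u n) 6 volume ≤ K * eLpNorm (fderiv ℝ (u n)) 2 volume := by
      rw [hK]
      exact_mod_cast h1
    refine h1.trans (mul_le_mul_right ?_ _)
    have h2 : eLpNorm (fderiv ℝ (u n)) 2 volume ≤ eLpNorm (fun x => ‖fderiv ℝ g x‖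
        + ((1 / ((n : ℝ) + 1)) * M) * ‖g x‖) 2 volume :=
      eLpNorm_mono_real fun x => (hpt n x).trans_eq (by ring)
    refine h2.trans ((eLpNorm_add_le ?_ ?_ (by norm_num)).trans ?_)
    · exact ((g.smooth 1).continuous_fderiv (by norm_num)).norm.aestronglyMeasurable
    · exact (g.continuous.norm.const_mul _).aestronglyMeasurable
    · rw [eLpNorm_norm]
      gcongr
      have := eLpNorm_const_smul (((1 / ((n : ℝ) + 1)) * M)) (fun x => ‖g x‖) 2 (volume : Measure V3)
      have h3 : (fun x => ((1 / ((n : ℝ) + 1)) * M) * ‖g x‖) 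
         = (((1 / ((n : ℝ) + 1)) * M)) • (fun x => ‖g x‖) := rfl
      rw [h3, this, eLpNorm_norm, Real.enorm_of_nonneg (by positivity)]
  have hlim : ∀ᵐ x ∂(volume : Measure V3), Filter.Tendsto (fun n => u n x) Filter.atTop (nhds (g x)) := by
    refine Filter.Eventually.of_forall fun x => ?_
    have h1 : Filter.Tendsto (fun n : ℕ => (1 / ((n : ℝ) + 1)) • x) Filter.atTop (nhds 0) := by
      simpa using (tendsto_one_div_add_atTop_nhds_zero_nat (𝕜 := ℝ)).smul_const x
    have h2 := ((φ.continuous.tendsto 0).comp h1).mul_const (g x)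
    have h3 : φ 0 = 1 := φ.one_of_mem_closedBall (by simp [φ])
    rw [h3, one_mul] at h2
    exact h2
  refine (Lp.eLpNorm_lim_le_liminf_eLpNorm (fun n => (hu n).continuous.aestronglyMeasurable) g hlim).trans ?_
  have hg2 : eLpNorm g 2 volume ≠ ⊤ := (g.memLp 2 volume).2.ne
  have ht : Filter.Tendsto (fun n : ℕ => (K : ENNReal) * (eLpNorm (fderiv ℝ g) 2 volume
      + ENNReal.ofReal ((1 / ((n : ℝ) + 1)) * M) * eLpNorm g 2 volume)) Filter.atTop
      (nhds (K * (eLpNorm (fderiv ℝ g) 2 volume + 0 * eLpNorm g 2 volume))) := by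
    refine ENNReal.Tendsto.const_mul (Filter.Tendsto.add tendsto_const_nhds
      (ENNReal.Tendsto.mul_const ?_ (Or.inr hg2))) (Or.inr (by simp))
    have := (tendsto_one_div_add_atTop_nhds_zero_nat (𝕜 := ℝ)).mul_const M
    rw [zero_mul] at this
    simpa using ENNReal.tendsto_ofReal this
  refine (Filter.liminf_le_liminf (Filter.Eventually.of_forall hb)).trans ?_
  rw [ht.liminf_eq]
  simp

lemma nrm_eq_eLpNorm (g : SR) : ENNReal.ofReal (nrm g) = eLpNorm g 2 volume := by
  rw [(g.memLp 2 volume).eLpNorm_eq_integral_rpow_norm (by norm_num) (by norm_num), nrm, ip,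
    Real.sqrt_eq_rpow]
  simp [← sq]

lemma eLpNorm_fderiv_le (g : SR) :
    eLpNorm (fderiv ℝ g) 2 volume ≤ ENNReal.ofReal (∑ j, nrm (dS j g)) := by
  have hpt : ∀ x, ‖fderiv ℝ g x‖ ≤ ∑ j, ‖dS j g x‖ := by
    intro x
    refine ContinuousLinearMap.opNorm_le_bound _ (by positivity) fun v => ?_
    have hv : v = ∑ j, v j • (Pi.single j 1 : V3) := by
      ext k
      simp [Finset.sum_apply, Pi.single_apply]
    conv_lhs => rw [hv]
    rw [map_sum, Finset.sum_mul]
    refine (norm_sum_le _ _).trans (Finset.sum_le_sum fun j _ => ?_)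
    rw [map_smul, norm_smul, mul_comm, dS_apply]
    gcongr
    exact norm_le_pi_norm v j
  refine (eLpNorm_mono_real hpt).trans ?_
  rw [ENNReal.ofReal_sum_of_nonneg fun _ _ => nrm_nonneg _]
  have h : (fun x => ∑ j, ‖dS j g x‖) = ∑ j, fun x => ‖dS j g x‖ := by
    ext x; simp
  rw [h]
  refine (eLpNorm_sum_le (fun j _ => (dS j g).continuous.norm.aestronglyMeasurable) 
    (by norm_num)).trans (Finset.sum_le_sum fun j _ => ?_)
  rw [eLpNorm_norm, nrm_eq_eLpNorm]

lemma exists_nrm_cube_le : ∃ K : ℝ, 0 < K ∧ ∀ g : SR,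
    nrm (mulS g (mulS g g)) ≤ K * (∑ j, nrm (dS j g)) ^ 3 := by
  obtain ⟨K, hK⟩ := eLpNorm_six_le
  refine ⟨(K : ℝ) ^ 3 + 1, by positivity, fun g => ?_⟩
  set G := ∑ j, nrm (dS j g) with hG
  have hG0 : 0 ≤ G := Finset.sum_nonneg fun _ _ => nrm_nonneg _
  have h1 := (hK g).trans (mul_le_mul_right (eLpNorm_fderiv_le g) (K : ENNReal))
  rw [(g.memLp 6 volume).eLpNorm_eq_integral_rpow_norm (by norm_num) (by norm_num), 
    ← ENNReal.ofReal_coe_nnreal, ← ENNReal.ofReal_mul (by positivity),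
    ENNReal.ofReal_le_ofReal_iff (by positivity)] at h1
  have h2 : ∫ x, ‖g x‖ ^ (6 : ENNReal).toReal = nrm (mulS g (mulS g g)) ^ 2 := by
    rw [nrm_sq, ip]
    refine integral_congr_ae (Filter.Eventually.of_forall fun x => ?_)
    simp only [ENNReal.toReal_ofNat, mulS_apply]
    rw [show (6:ℝ) = ((6:ℕ):ℝ) by norm_num, Real.rpow_natCast, Real.norm_eq_abs, Even.pow_abs (by decide)]
    ring
  have hn := nrm_nonneg (mulS g (mulS g g))
  rw [h2] at h1
  have h3 := pow_le_pow_left₀ (by positivity) h1 6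
  rw [← Real.rpow_natCast, ← Real.rpow_mul (by positivity)] at h3
  norm_num at h3
  have h4 : nrm (mulS g (mulS g g)) ≤ (K * G) ^ 3 :=
    abs_le_of_sq_le_sq' (by rw [← pow_mul]; exact h3) (by positivity) |>.2
  rw [mul_pow] at h4
  nlinarith [pow_nonneg hG0 3]

/-- The scalar `H¹_α` energy. -/
def h1a (α : ℝ) (g : SR) : ℝ := ip g g + α ^ 2 * ∑ j, ip (dS j g) (dS j g)

/-- A scaled Ladyzhenskaya inequality. -/
lemma exists_nrm_sq_le : ∃ K : ℝ, 0 < K ∧ ∀ (α : ℝ), 0 < α → ∀ g : SR,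
    α ^ 3 * nrm (mulS g g) ^ 2 ≤ (K * h1a α g) ^ 2 := by
  obtain ⟨K, hK, h⟩ := exists_nrm_cube_le
  refine ⟨K + 27, by positivity, fun α hα g => ?_⟩
  set G := ∑ j, nrm (dS j g) with hG
  have hG0 : 0 ≤ G := Finset.sum_nonneg fun _ _ => nrm_nonneg _
  have hn := nrm_nonneg g
  have h1 : nrm (mulS g g) ^ 2 ≤ nrm g * (K * G ^ 3) := by
    rw [nrm_sq, ip_mulS]
    exact (le_abs_self _).trans ((abs_ip_le _ _).trans (mul_le_mul_of_nonneg_left (h g) hn))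
  have hE : h1a α g = nrm g ^ 2 + α ^ 2 * ∑ j, nrm (dS j g) ^ 2 := by
    simp only [h1a, nrm_sq]
  have hE0 : 0 ≤ h1a α g := by rw [hE]; positivity
  have h2 : (α * G) ^ 2 ≤ 3 * h1a α g := by
    have : G ^ 2 ≤ 3 * ∑ j, nrm (dS j g) ^ 2 := by
      have := sq_sum_le_card_mul_sum_sq (s := Finset.univ) (f := fun j => nrm (dS j g))
      simpa using this
    rw [hE, mul_pow]
    nlinarith [mul_le_mul_of_nonneg_left this (sq_nonneg α), sq_nonneg (nrm g)]
  have h3 : nrm g ^ 2 ≤ h1a α g := by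
    rw [hE]
    have : 0 ≤ α ^ 2 * ∑ j, nrm (dS j g) ^ 2 := by positivity
    linarith
  have h4 : (nrm g * (α * G) ^ 3) ^ 2 ≤ (9 * h1a α g ^ 2) ^ 2 := by
    calc (nrm g * (α * G) ^ 3) ^ 2 = nrm g ^ 2 * ((α * G) ^ 2) ^ 3 := by ring
      _ ≤ h1a α g * (3 * h1a α g) ^ 3 := by gcongr
      _ ≤ (9 * h1a α g ^ 2) ^ 2 := by nlinarith [pow_nonneg hE0 4]
  have h5 : nrm g * (α * G) ^ 3 ≤ 9 * h1a α g ^ 2 :=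
    le_of_sq_le_sq h4 (by positivity)
  calc α ^ 3 * nrm (mulS g g) ^ 2 ≤ α ^ 3 * (nrm g * (K * G ^ 3)) := by gcongr
    _ = K * (nrm g * (α * G) ^ 3) := by ring
    _ ≤ K * (9 * h1a α g ^ 2) := by gcongr
    _ ≤ ((K + 27) * h1a α g) ^ 2 := by nlinarith [mul_nonneg hK.le (sq_nonneg (h1a α g)), sq_nonneg (h1a α g), sq_nonneg (K * h1a α g)]

/-! ## Estimates for the nonlinear term -/

lemma h1a_le_hip (α : ℝ) (a : Fin 3 → SR) (i : Fin 3) : h1a α (a i) ≤ hip α a a :=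
  Finset.single_le_sum (f := fun i => h1a α (a i)) (fun _ _ => add_nonneg (ip_self_nonneg _)
    (mul_nonneg (sq_nonneg _) (Finset.sum_nonneg fun _ _ => ip_self_nonneg _)))
    (Finset.mem_univ i)

lemma nrm_le_sqrt_hip (α : ℝ) (a : Fin 3 → SR) (i : Fin 3) : nrm (a i) ≤ √(hip α a a) := by
  refine Real.sqrt_le_sqrt (le_trans ?_ (h1a_le_hip α a i))
  exact le_add_of_nonneg_right
    (mul_nonneg (sq_nonneg _) (Finset.sum_nonneg fun _ _ => ip_self_nonneg _))

lemma nrm_dS_le_sqrt_hip {α : ℝ} (hα : 0 < α) (a : Fin 3 → SR) (i j : Fin 3) :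
    nrm (dS j (a i)) ≤ α⁻¹ * √(hip α a a) := by
  rw [inv_mul_eq_div, le_div_iff₀ hα]
  refine Real.le_sqrt_of_sq_le (le_trans ?_ (h1a_le_hip α a i))
  rw [mul_pow, nrm_sq, h1a]
  have h := Finset.single_le_sum (f := fun j => ip (dS j (a i)) (dS j (a i)))
    (fun _ _ => ip_self_nonneg _) (Finset.mem_univ j)
  nlinarith [ip_self_nonneg (a i), mul_le_mul_of_nonneg_left h (sq_nonneg α)]

lemma nrm_mulS_sq_le (f g : SR) : nrm (mulS f g) ^ 2 ≤ nrm (mulS f f) * nrm (mulS g g) := by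
  have h : nrm (mulS f g) ^ 2 = ip (mulS f f) (mulS g g) := by
    rw [nrm_sq, ip, ip]
    congr 1; ext x; simp; ring
  rw [h]
  exact (le_abs_self _).trans (abs_ip_le _ _)

lemma exists_trilinear_le : ∃ c : ℝ, 0 < c ∧ ∀ α : ℝ, 0 < α → ∀ U w : Fin 3 → SR,
    α ^ 2 * √α * |∑ i, ip (∑ j, mulS (w j) (dS j (U i))) (w i)|
      ≤ c * √(hip α U U) * hip α w w := by
  obtain ⟨K, hK, h⟩ := exists_nrm_sq_le
  refine ⟨9 * K, by positivity, fun α hα U w => ?_⟩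
  set s := α * √α with hs
  have hs0 : 0 ≤ s := by positivity
  have hs2 : s ^ 2 = α ^ 3 := by rw [hs, mul_pow, Real.sq_sqrt hα.le]; ring
  have hE := hip_self_nonneg α w
  have h1 : ∀ i, s * nrm (mulS (w i) (w i)) ≤ K * hip α w w := fun i => by
    refine le_of_sq_le_sq ?_ (by positivity)
    rw [mul_pow, hs2]
    refine (h α hα (w i)).trans ?_
    have h0 : 0 ≤ h1a α (w i) := add_nonneg (ip_self_nonneg _)
      (mul_nonneg (sq_nonneg _) (Finset.sum_nonneg fun _ _ => ip_self_nonneg _))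
    have := h1a_le_hip α w i
    gcongr
  have h2 : ∀ i j, s * nrm (mulS (w j) (w i)) ≤ K * hip α w w := fun i j => by
    refine le_of_sq_le_sq ?_ (by positivity)
    calc (s * nrm (mulS (w j) (w i))) ^ 2 = s ^ 2 * nrm (mulS (w j) (w i)) ^ 2 := by ring
      _ ≤ s ^ 2 * (nrm (mulS (w j) (w j)) * nrm (mulS (w i) (w i))) := by
        gcongr; exact nrm_mulS_sq_le _ _
      _ = (s * nrm (mulS (w j) (w j))) * (s * nrm (mulS (w i) (w i))) := by ring
      _ ≤ (K * hip α w w) * (K * hip α w w) :=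
        mul_le_mul (h1 j) (h1 i) (mul_nonneg hs0 (nrm_nonneg _)) (by positivity)
      _ = _ := by ring
  have h3 : ∀ i j, α ^ 2 * √α * |ip (mulS (w j) (dS j (U i))) (w i)|
      ≤ √(hip α U U) * (K * hip α w w) := fun i j => by
    have e : ip (mulS (w j) (dS j (U i))) (w i) = ip (dS j (U i)) (mulS (w j) (w i)) := by
      rw [mulS_comm, ip_mulS]
    rw [e]
    calc α ^ 2 * √α * |ip (dS j (U i)) (mulS (w j) (w i))|
        ≤ α ^ 2 * √α * (nrm (dS j (U i)) * nrm (mulS (w j) (w i))) := by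
          gcongr; exact abs_ip_le _ _
      _ = (α * nrm (dS j (U i))) * (s * nrm (mulS (w j) (w i))) := by rw [hs]; ring
      _ ≤ √(hip α U U) * (K * hip α w w) := by
        refine mul_le_mul ?_ (h2 i j) (mul_nonneg hs0 (nrm_nonneg _)) (Real.sqrt_nonneg _)
        have := nrm_dS_le_sqrt_hip hα U i j
        rwa [inv_mul_eq_div, le_div_iff₀ hα, mul_comm] at this
  calc α ^ 2 * √α * |∑ i, ip (∑ j, mulS (w j) (dS j (U i))) (w i)|
      ≤ α ^ 2 * √α * ∑ i, ∑ j, |ip (mulS (w j) (dS j (U i))) (w i)| := by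
        gcongr
        refine (Finset.abs_sum_le_sum_abs _ _).trans (Finset.sum_le_sum fun i _ => ?_)
        rw [ip_sum_left]
        exact Finset.abs_sum_le_sum_abs _ _
    _ = ∑ i, ∑ j, α ^ 2 * √α * |ip (mulS (w j) (dS j (U i))) (w i)| := by
        simp only [Finset.mul_sum]
    _ ≤ ∑ _i : Fin 3, ∑ _j : Fin 3, √(hip α U U) * (K * hip α w w) :=
        Finset.sum_le_sum fun i _ => Finset.sum_le_sum fun j _ => h3 i j
    _ = 9 * K * √(hip α U U) * hip α w w := by simp; ring

/-- The a priori bound for stationary solutions. -/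
lemma sqrt_hip_le_of_stationary {α β ν : ℝ} (hν : 0 < ν) (U M f : Fin 3 → SR) (q : SR)
    (hU : ∑ j, dS j (U j) = 0)
    (hM : ∀ i, M i - α ^ 2 • lap (M i) = ∑ j, mulS (U j) (dS j (U i)))
    (hf : ∀ i, -f i = ν • lap (U i) + (-1 : ℝ) • M i + (-1 : ℝ) • dS i q + (-β) • U i) :
    β * √(hip α U U) ≤ √(hip α f f) := by
  have h := hip_rhs_le hν U M _ (fun i => -f i) q hU hM hf
  have h0 : ∑ i, ip (∑ j, mulS (U j) (dS j (U i))) (U i) = 0 :=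
    Finset.sum_eq_zero fun i _ => by rw [ip_sum_left, transport_eq_zero U hU]
  have h1 : hip α (fun i => -f i) U = -hip α f U := by
    have := hip_smul_left α (-1) f U
    simpa using this
  have h2 := (le_abs_self _).trans (abs_hip_le α f U)
  rw [h0, h1] at h
  rcases (Real.sqrt_nonneg (hip α U U)).eq_or_lt with h3 | h3
  · rw [← h3, mul_zero]; exact Real.sqrt_nonneg _
  · refine le_of_mul_le_mul_right ?_ h3
    rw [mul_assoc, Real.mul_self_sqrt (hip_self_nonneg α U)]
    linarith

/-- The linearised convection term around `U`. -/
def convection (U w : Fin 3 → SR) (i : Fin 3) : SR :=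
  ∑ j, (mulS (w j) (dS j (U i)) + mulS (U j + w j) (dS j (w i)))

lemma sum_ip_convection (U w : Fin 3 → SR) (hU : ∑ j, dS j (U j) = 0) (hw : ∑ j, dS j (w j) = 0) :
    ∑ i, ip (convection U w i) (w i) = ∑ i, ip (∑ j, mulS (w j) (dS j (U i))) (w i) := by
  refine Finset.sum_congr rfl fun i _ => ?_
  have h := transport_eq_zero (fun j => U j + w j)
    (by simp only [map_add, Finset.sum_add_distrib, hU, hw, add_zero]) (w i)
  rw [convection, Finset.sum_add_distrib, ip_add_left, ip_sum_left _ (w i) fun j => mulS (U j + w j) _, h,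
    add_zero]

/-- The `H²`-level energy pairing. -/
def hip2 (α : ℝ) (a b : Fin 3 → SR) : ℝ :=
  ∑ k, hip α (fun i => dS k (a i)) (fun i => dS k (b i))

lemma hip2_self_nonneg (α : ℝ) (a : Fin 3 → SR) : 0 ≤ hip2 α a a :=
  Finset.sum_nonneg fun _ _ => hip_self_nonneg _ _

lemma hip2_rhs_le {α β ν : ℝ} (hν : 0 < ν) (a M B r : Fin 3 → SR) (q : SR)
    (ha : ∑ j, dS j (a j) = 0) (hM : ∀ i, M i - α ^ 2 • lap (M i) = B i)
    (hr : ∀ i, r i = ν • lap (a i) + (-1 : ℝ) • M i + (-1 : ℝ) • dS i q + (-β) • a i) :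
    hip2 α r a ≤ -β * hip2 α a a + ∑ i, ip (B i) (lap (a i)) := by
  have h : ∀ k, hip α (fun i => dS k (r i)) (fun i => dS k (a i))
      ≤ -β * hip α (fun i => dS k (a i)) (fun i => dS k (a i))
        - ∑ i, ip (dS k (B i)) (dS k (a i)) := fun k => by
    refine hip_rhs_le hν _ (fun i => dS k (M i)) _ _ (dS k q) ?_ (fun i => ?_) (fun i => ?_)
    · simp only [dS_comm _ k]
      rw [← map_sum, ha, map_zero]
    · rw [← hM, map_sub, map_smul, dS_lap]
    · rw [hr, map_add, map_add, map_add, map_smul, map_smul, map_smul, map_smul, dS_lap,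
        dS_comm k i]
  refine (Finset.sum_le_sum fun k _ => h k).trans_eq ?_
  rw [Finset.sum_sub_distrib, hip2, Finset.mul_sum, Finset.sum_comm]
  simp only [ip_lap_right, Finset.sum_neg_distrib]
  ring

lemma nrm_lap_le_sqrt_hip2 {α : ℝ} (hα : 0 < α) (a : Fin 3 → SR) (i : Fin 3) :
    nrm (lap (a i)) ≤ 3 * α⁻¹ * √(hip2 α a a) := by
  have h : ∀ j, nrm (dS j (dS j (a i))) ≤ α⁻¹ * √(hip2 α a a) := fun j => by
    refine (nrm_dS_le_sqrt_hip hα (fun i => dS j (a i)) i j).trans ?_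
    gcongr
    exact Finset.single_le_sum
      (f := fun k => hip α (fun i => dS k (a i)) (fun i => dS k (a i)))
      (fun _ _ => hip_self_nonneg _ _) (Finset.mem_univ j)
  refine (nrm_lap_le _).trans ((Finset.sum_le_sum fun j _ => h j).trans_eq ?_)
  simp; ring

lemma exists_sup_le {α : ℝ} (hα : 0 < α) : ∃ K : ℝ, 0 < K ∧ ∀ (w : Fin 3 → SR) (i : Fin 3) (x : V3),
    |w i x| ≤ K * (√(hip α w w) + √(hip2 α w w)) := by
  obtain ⟨K, hK, h⟩ := exists_abs_le_nrm_add_nrm_lap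
  refine ⟨K * (1 + 3 * α⁻¹), by positivity, fun w i x => (h (w i) x).trans ?_⟩
  rw [mul_assoc]
  gcongr
  have h1 := nrm_le_sqrt_hip α w i
  have h2 := nrm_lap_le_sqrt_hip2 hα w i
  have h3 : 0 ≤ 3 * α⁻¹ * √(hip α w w) := by positivity
  have h4 := Real.sqrt_nonneg (hip2 α w w)
  linarith

lemma exists_bound_SR (g : SR) : ∃ R : ℝ, ∀ x, |g x| ≤ R := by
  obtain ⟨R, hR⟩ := g.decay 0 0
  exact ⟨R, fun x => by simpa using hR.2 x⟩

lemma nrm_sum_le (g : Fin 3 → SR) : nrm (∑ j, g j) ≤ ∑ j, nrm (g j) := by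
  rw [Fin.sum_univ_three, Fin.sum_univ_three]
  exact (nrm_add_le _ _).trans (add_le_add_left (nrm_add_le _ _) _)

lemma exists_convection_lap_le {α : ℝ} (hα : 0 < α) (U : Fin 3 → SR) : ∃ K : ℝ, 0 < K ∧
    ∀ w : Fin 3 → SR, ∑ i, ip (convection U w i) (lap (w i))
      ≤ K * (1 + √(hip α w w) + √(hip2 α w w)) * (√(hip α w w) * √(hip2 α w w)) := by
  obtain ⟨S, hS, hsup⟩ := exists_sup_le hα
  obtain ⟨R, hR, hRU, hRD⟩ : ∃ R : ℝ, 0 < R ∧ (∀ j x, |U j x| ≤ R) ∧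
      ∀ i j x, |dS j (U i) x| ≤ R := by
    choose A hA using fun j => exists_bound_SR (U j)
    choose D hD using fun i j => exists_bound_SR (dS j (U i))
    have hA0 : ∀ j, 0 ≤ A j := fun j => (abs_nonneg _).trans (hA j 0)
    have hD0 : ∀ i j, 0 ≤ D i j := fun i j => (abs_nonneg _).trans (hD i j 0)
    have hD1 : ∀ i j, D i j ≤ ∑ i, ∑ j, D i j := fun i j =>
      (Finset.single_le_sum (fun j _ => hD0 i j) (Finset.mem_univ j)).trans
        (Finset.single_le_sum (f := fun i => ∑ j, D i j)
          (fun i _ => Finset.sum_nonneg fun j _ => hD0 i j) (Finset.mem_univ i))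
    have hA1 : ∀ j, A j ≤ ∑ j, A j := fun j =>
      Finset.single_le_sum (fun j _ => hA0 j) (Finset.mem_univ j)
    have hAs : 0 ≤ ∑ j, A j := Finset.sum_nonneg fun j _ => hA0 j
    have hDs : 0 ≤ ∑ i, ∑ j, D i j :=
      Finset.sum_nonneg fun i _ => Finset.sum_nonneg fun j _ => hD0 i j
    refine ⟨1 + ∑ j, A j + ∑ i, ∑ j, D i j, by linarith, fun j x => ?_, fun i j x => ?_⟩
    · linarith [hA j x, hA1 j]
    · linarith [hD i j x, hD1 i j]
  refine ⟨27 * α⁻¹ * (R + (R + S) * α⁻¹), by positivity, fun w => ?_⟩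
  set e₁ := √(hip α w w)
  set e₂ := √(hip2 α w w)
  have he₁ : 0 ≤ e₁ := Real.sqrt_nonneg _
  have he₂ : 0 ≤ e₂ := Real.sqrt_nonneg _
  have hB : ∀ i, nrm (convection U w i) ≤ 3 * (R + (R + S * (e₁ + e₂)) * α⁻¹) * e₁ := fun i => by
    have h1 : ∀ j, nrm (mulS (w j) (dS j (U i)) + mulS (U j + w j) (dS j (w i)))
        ≤ (R + (R + S * (e₁ + e₂)) * α⁻¹) * e₁ := fun j => by
      refine (nrm_add_le _ _).trans ?_
      rw [add_mul, mul_assoc (R + _)]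
      refine add_le_add ?_ ?_
      · rw [mulS_comm]
        refine (nrm_mulS_le hR.le _ _ (hRD i j)).trans ?_
        gcongr
        exact nrm_le_sqrt_hip α w j
      · refine (nrm_mulS_le (M := R + S * (e₁ + e₂)) (by positivity) _ _ fun x => ?_).trans ?_
        · exact (abs_add_le _ _).trans (add_le_add (hRU j x) (hsup w j x))
        · gcongr
          exact nrm_dS_le_sqrt_hip hα w i j
    refine (nrm_sum_le _).trans ((Finset.sum_le_sum fun j _ => h1 j).trans_eq ?_)
    simp; ring
  have hterm : ∀ i, ip (convection U w i) (lap (w i))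
      ≤ (3 * (R + (R + S * (e₁ + e₂)) * α⁻¹) * e₁) * (3 * α⁻¹ * e₂) := fun i =>
    (le_abs_self _).trans ((abs_ip_le _ _).trans (mul_le_mul (hB i) (nrm_lap_le_sqrt_hip2 hα w i)
      (nrm_nonneg _) (by positivity)))
  refine (Finset.sum_le_sum fun i _ => hterm i).trans ?_
  have h2 : R + (R + S * (e₁ + e₂)) * α⁻¹ ≤ (R + (R + S) * α⁻¹) * (1 + e₁ + e₂) := by
    have : 0 ≤ (R * (e₁ + e₂) + (R * (e₁ + e₂) + S) * α⁻¹) := by positivity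
    linarith
  calc ∑ _i : Fin 3, (3 * (R + (R + S * (e₁ + e₂)) * α⁻¹) * e₁) * (3 * α⁻¹ * e₂)
      = 27 * α⁻¹ * (R + (R + S * (e₁ + e₂)) * α⁻¹) * (e₁ * e₂) := by simp; ring
    _ ≤ 27 * α⁻¹ * ((R + (R + S) * α⁻¹) * (1 + e₁ + e₂)) * (e₁ * e₂) := by gcongr
    _ = _ := by ring

/-! ## Time-dependent families of Schwartz functions -/

/-- A family of Schwartz functions, jointly smooth for positive times and bounded in the Schwartz
space on bounded time intervals. -/
structure Fam (a : ℝ → SR) : Prop where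
  smooth : ContDiffOn ℝ (⊤ : ℕ∞) (fun q : ℝ × V3 => a q.1 q.2) (Ioi (0 : ℝ) ×ˢ univ)
  bdd : ∀ T, Bornology.IsVonNBounded ℝ (a '' Ioo (0 : ℝ) T)

lemma isOpen_posTime : IsOpen (Ioi (0 : ℝ) ×ˢ (univ : Set V3)) := isOpen_Ioi.prod isOpen_univ

lemma mem_posTime {t : ℝ} (ht : 0 < t) (x : V3) : (t, x) ∈ Ioi (0 : ℝ) ×ˢ (univ : Set V3) :=
  ⟨ht, mem_univ x⟩

lemma Fam.contDiffAt {a : ℝ → SR} (ha : Fam a) {t : ℝ} (ht : 0 < t) (x : V3) :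
    ContDiffAt ℝ (⊤ : ℕ∞) (fun q : ℝ × V3 => a q.1 q.2) (t, x) :=
  ha.smooth.contDiffAt (isOpen_posTime.mem_nhds (mem_posTime ht x))

lemma Fam.differentiableAt {a : ℝ → SR} (ha : Fam a) {t : ℝ} (ht : 0 < t) (x : V3) :
    DifferentiableAt ℝ (fun q : ℝ × V3 => a q.1 q.2) (t, x) :=
  (ha.contDiffAt ht x).differentiableAt (by simp)

lemma Fam.hasDerivAt {a : ℝ → SR} (ha : Fam a) {t : ℝ} (ht : 0 < t) (x : V3) :
    HasDerivAt (fun s => a s x) (fderiv ℝ (fun q : ℝ × V3 => a q.1 q.2) (t, x) (1, 0)) t := by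
  have h := (ha.differentiableAt ht x).hasFDerivAt
  exact h.comp_hasDerivAt t ((hasDerivAt_id t).prodMk (hasDerivAt_const t x))

lemma Fam.dS_eq {a : ℝ → SR} (ha : Fam a) (j : Fin 3) {t : ℝ} (ht : 0 < t) (x : V3) :
    dS j (a t) x = fderiv ℝ (fun q : ℝ × V3 => a q.1 q.2) (t, x) (0, Pi.single j 1) := by
  have h : HasFDerivAt (a t) ((fderiv ℝ (fun q : ℝ × V3 => a q.1 q.2) (t, x)).comp
      (ContinuousLinearMap.inr ℝ ℝ V3)) x :=
    (ha.differentiableAt ht x).hasFDerivAt.comp x (hasFDerivAt_prodMk_right t x)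
  rw [dS_apply, h.fderiv]
  simp

lemma Fam.dS {a : ℝ → SR} (ha : Fam a) (j : Fin 3) : Fam fun t => dS j (a t) where
  smooth := by
    have h := (ha.smooth.fderiv_of_isOpen isOpen_posTime (m := (⊤ : ℕ∞)) (by simp)).clm_apply
      (contDiffOn_const (c := ((0 : ℝ), (Pi.single j 1 : V3))))
    exact h.congr fun q hq => ha.dS_eq j hq.1 q.2
  bdd T := by
    have := (ha.bdd T).image (_root_.dS j)
    rwa [image_image] at this

lemma Fam.add {a b : ℝ → SR} (ha : Fam a) (hb : Fam b) : Fam fun t => a t + b t where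
  smooth := ha.smooth.add hb.smooth
  bdd T := ((ha.bdd T).add (hb.bdd T)).subset <| by
    rintro _ ⟨t, ht, rfl⟩
    exact add_mem_add (mem_image_of_mem _ ht) (mem_image_of_mem _ ht)

lemma Fam.smul {a : ℝ → SR} (ha : Fam a) (c : ℝ) : Fam fun t => c • a t where
  smooth := contDiffOn_const.smul ha.smooth
  bdd T := by
    have := (ha.bdd T).image (c • ContinuousLinearMap.id ℝ SR)
    rwa [image_image] at this

lemma Fam.const (g : SR) : Fam fun _ => g where
  smooth := ((g.smooth _).comp contDiff_snd).contDiffOn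
  bdd T := (Bornology.isVonNBounded_singleton g).subset <| by
    rintro _ ⟨t, _, rfl⟩; rfl

lemma Fam.sub {a b : ℝ → SR} (ha : Fam a) (hb : Fam b) : Fam fun t => a t - b t := by
  simpa [sub_eq_add_neg] using ha.add (hb.smul (-1))

lemma Fam.lap {a : ℝ → SR} (ha : Fam a) : Fam fun t => lap (a t) := by
  simp only [lap_apply, Fin.sum_univ_three]
  exact (((ha.dS 0).dS 0).add ((ha.dS 1).dS 1)).add ((ha.dS 2).dS 2)

/-- `r` is the pointwise time derivative of `a` at positive times. -/
def TD (a r : ℝ → SR) : Prop := ∀ t > 0, ∀ x, HasDerivAt (fun s => a s x) (r t x) t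

lemma TD.dS {a r : ℝ → SR} (ha : Fam a) (h : TD a r) (j : Fin 3) :
    TD (fun t => dS j (a t)) fun t => dS j (r t) := by
  intro t ht x
  set F := fun q : ℝ × V3 => a q.1 q.2 with hF
  have hr : ∀ y, r t y = fderiv ℝ F (t, y) (1, 0) := fun y =>
    (h t ht y).unique (ha.hasDerivAt ht y)
  have hd : HasFDerivAt (fderiv ℝ F) (fderiv ℝ (fderiv ℝ F) (t, x)) (t, x) :=
    (((ha.contDiffAt ht x).fderiv_right (m := (⊤ : ℕ∞)) (by simp)).differentiableAt
      (by simp)).hasFDerivAt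
  have hs : IsSymmSndFDerivAt ℝ F (t, x) := (contDiffAt_infty.1 (ha.contDiffAt ht x) 2).isSymmSndFDerivAt
    (by simp)
  have e1 : _root_.dS j (r t) x = fderiv ℝ (fderiv ℝ F) (t, x) (0, Pi.single j 1) (1, 0) := by
    have h1 : HasFDerivAt (r t) _ x :=
      ((hd.clm_apply (hasFDerivAt_const ((1 : ℝ), (0 : V3)) (t, x))).comp x
        (hasFDerivAt_prodMk_right t x)).congr_of_eventuallyEq
          (Filter.Eventually.of_forall fun y => hr y)
    rw [dS_apply, h1.fderiv]
    simp
  have h2 : HasDerivAt (fun s => fderiv ℝ F (s, x) (0, Pi.single j 1))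
      (fderiv ℝ (fderiv ℝ F) (t, x) (1, 0) (0, Pi.single j 1)) t := by
    have := (hd.clm_apply (hasFDerivAt_const ((0 : ℝ), (Pi.single j 1 : V3))
      (t, x))).comp_hasDerivAt t ((hasDerivAt_id t).prodMk (hasDerivAt_const t x))
    refine this.congr_deriv ?_
    simp
  rw [e1, hs]
  refine h2.congr_of_eventuallyEq ?_
  filter_upwards [lt_mem_nhds ht] with s hs
  exact ha.dS_eq j hs x

lemma exists_decay_of_isVonNBounded {S : Set SR} (hS : Bornology.IsVonNBounded ℝ S) (k : ℕ) :
    ∃ C : ℝ, 0 ≤ C ∧ ∀ g ∈ S, ∀ x, (1 + ‖x‖) ^ k * |g x| ≤ C := by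
  obtain ⟨C, hC, h⟩ := (schwartz_withSeminorms ℝ V3 ℝ).isVonNBounded_iff_finset_seminorm_bounded.1
    hS (Finset.Iic (k, 0))
  refine ⟨2 ^ k * C, by positivity, fun g hg x => ?_⟩
  have h1 := SchwartzMap.one_add_le_sup_seminorm_apply (𝕜 := ℝ) (m := (k, 0)) (le_refl k)
    (le_refl 0) g x
  rw [norm_iteratedFDeriv_zero, Real.norm_eq_abs] at h1
  exact h1.trans (mul_le_mul_of_nonneg_left (h g hg).le (by positivity))

lemma TD.hasDerivAt_ip {a r : ℝ → SR} (h : TD a r) (ha : Fam a) (hr : Fam r) {t : ℝ}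
    (ht : 0 < t) : HasDerivAt (fun s => ip (a s) (a s)) (2 * ip (r t) (a t)) t := by
  obtain ⟨A, hA, hab⟩ := exists_decay_of_isVonNBounded (ha.bdd (t + 1)) 4
  obtain ⟨R, hR, hrb⟩ := exists_decay_of_isVonNBounded (hr.bdd (t + 1)) 0
  have hint : Integrable (fun x : V3 => 2 * R * A * (1 + ‖x‖) ^ (-4 : ℝ)) :=
    (integrable_one_add_norm (by simp; norm_num)).const_mul _
  have key := hasDerivAt_integral_of_dominated_loc_of_deriv_le (μ := (volume : Measure V3))
    (F := fun s x => a s x * a s x) (F' := fun s x => 2 * (r s x * a s x)) (x₀ := t)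
    (s := Ioo 0 (t + 1)) (Ioo_mem_nhds ht (by linarith))
    (Filter.Eventually.of_forall fun s => (integrable_mul (a s) (a s)).aestronglyMeasurable)
    (integrable_mul (a t) (a t)) ((integrable_mul (r t) (a t)).const_mul 2).aestronglyMeasurable
    (Filter.Eventually.of_forall fun x s hs => ?_) hint
    (Filter.Eventually.of_forall fun x s hs => ?_)
  · have := key.2
    rwa [integral_const_mul] at this
  · have h1 := hab _ (mem_image_of_mem _ hs) x
    have h2 := hrb _ (mem_image_of_mem _ hs) x
    have hx : 0 < 1 + ‖x‖ := by positivity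
    rw [pow_zero, one_mul] at h2
    rw [show (-4 : ℝ) = -((4 : ℕ) : ℝ) by norm_num, Real.rpow_neg hx.le, Real.rpow_natCast,
      ← div_eq_mul_inv, le_div_iff₀ (by positivity), Real.norm_eq_abs, abs_mul, abs_mul, abs_two]
    calc 2 * (|r s x| * |a s x|) * (1 + ‖x‖) ^ 4 = 2 * |r s x| * ((1 + ‖x‖) ^ 4 * |a s x|) := by
          ring
      _ ≤ 2 * R * A := by gcongr
  · have := (h s hs.1 x).mul (h s hs.1 x)
    exact this.congr_deriv (by ring)

lemma TD.hasDerivAt_hip {a r : Fin 3 → ℝ → SR} (h : ∀ i, TD (a i) (r i)) (ha : ∀ i, Fam (a i))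
    (hr : ∀ i, Fam (r i)) (α : ℝ) {t : ℝ} (ht : 0 < t) :
    HasDerivAt (fun s => hip α (fun i => a i s) fun i => a i s)
      (2 * hip α (fun i => r i t) fun i => a i t) t := by
  have := HasDerivAt.fun_sum (u := Finset.univ) fun i _ =>
    ((h i).hasDerivAt_ip (ha i) (hr i) ht).fun_add ((HasDerivAt.fun_sum (u := Finset.univ) fun j _ =>
      ((h i).dS (ha i) j).hasDerivAt_ip ((ha i).dS j) ((hr i).dS j) ht).const_mul (α ^ 2))
  refine this.congr_deriv ?_
  simp only [hip, Finset.mul_sum, mul_add]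
  refine Finset.sum_congr rfl fun i _ => ?_
  congr 1
  refine Finset.sum_congr rfl fun j _ => ?_
  ring

lemma TD.hasDerivAt_hip2 {a r : Fin 3 → ℝ → SR} (h : ∀ i, TD (a i) (r i)) (ha : ∀ i, Fam (a i))
    (hr : ∀ i, Fam (r i)) (α : ℝ) {t : ℝ} (ht : 0 < t) :
    HasDerivAt (fun s => hip2 α (fun i => a i s) fun i => a i s)
      (2 * hip2 α (fun i => r i t) fun i => a i t) t := by
  have := HasDerivAt.fun_sum (u := Finset.univ) fun k _ =>
    TD.hasDerivAt_hip (fun i => (h i).dS (ha i) k) (fun i => (ha i).dS k) (fun i => (hr i).dS k) α ht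
  refine this.congr_deriv ?_
  simp only [hip2, Finset.mul_sum]

/-! ## Differential inequalities -/

lemma le_exp_of_deriv_le {E D : ℝ → ℝ} {γ t₁ : ℝ} (hE : ∀ t ≥ t₁, HasDerivAt E (D t) t)
    (hD : ∀ t ≥ t₁, D t ≤ -γ * E t) : ∀ t ≥ t₁, E t ≤ E t₁ * Real.exp (-γ * (t - t₁)) := by
  have hd : ∀ t ≥ t₁, HasDerivAt (fun s => E s * Real.exp (γ * (s - t₁)))
      ((D t + γ * E t) * Real.exp (γ * (t - t₁))) t := fun t ht => by
    have h1 : HasDerivAt (fun s => Real.exp (γ * (s - t₁))) (Real.exp (γ * (t - t₁)) * (γ * 1)) t :=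
      (((hasDerivAt_id t).sub_const t₁).const_mul γ).exp
    exact ((hE t ht).mul h1).congr_deriv (by ring)
  have hanti : AntitoneOn (fun s => E s * Real.exp (γ * (s - t₁))) (Ici t₁) := by
    refine antitoneOn_of_deriv_nonpos (convex_Ici _)
      (fun t ht => (hd t ht).continuousAt.continuousWithinAt)
      (fun t ht => (hd t (interior_subset ht)).differentiableAt.differentiableWithinAt)
      fun t ht => ?_
    have ht' : t ≥ t₁ := interior_subset ht
    rw [(hd t ht').deriv]
    exact mul_nonpos_of_nonpos_of_nonneg (by linarith [hD t ht']) (Real.exp_pos _).le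
  intro t ht
  have := hanti (mem_Ici.2 le_rfl) (mem_Ici.2 ht) ht
  simp only [sub_self, mul_zero, Real.exp_zero, mul_one] at this
  rw [neg_mul, Real.exp_neg, ← div_eq_mul_inv, le_div_iff₀ (Real.exp_pos _)]
  exact this

lemma exists_decay_of_energy {E₁ E₂ D₁ D₂ : ℝ → ℝ} {η β K : ℝ} (hη : 0 < η) (hβ : 0 < β)
    (hK : 0 < K) (hE₁ : ∀ t, 0 ≤ E₁ t) (hE₂ : ∀ t, 0 ≤ E₂ t)
    (hd₁ : ∀ t > 0, HasDerivAt E₁ (D₁ t) t) (hd₂ : ∀ t > 0, HasDerivAt E₂ (D₂ t) t)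
    (h₁ : ∀ t > 0, D₁ t ≤ -(2 * η) * E₁ t)
    (h₂ : ∀ t > 0, D₂ t ≤ -(2 * β) * E₂ t
      + 2 * (K * (1 + √(E₁ t) + √(E₂ t)) * (√(E₁ t) * √(E₂ t)))) :
    ∃ C > 0, ∃ t₁ ≥ (1 : ℝ), ∀ t ≥ t₁, √(E₁ t) + √(E₂ t) ≤ C * t ^ (-(3 : ℝ) / 4) := by
  have hdec := le_exp_of_deriv_le (t₁ := 1) (fun t ht => hd₁ t (by linarith))
    (fun t ht => h₁ t (by linarith))
  have hlim : Filter.Tendsto (fun t => √(E₁ t)) Filter.atTop (nhds 0) := by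
    have h0 : Filter.Tendsto (fun t : ℝ => E₁ 1 * Real.exp (-(2 * η) * (t - 1))) Filter.atTop
        (nhds (E₁ 1 * 0)) := by
      refine Filter.Tendsto.const_mul _ (Real.tendsto_exp_atBot.comp ?_)
      exact (Filter.tendsto_atTop_add_const_right _ (-1) Filter.tendsto_id).const_mul_atTop_of_neg
        (by linarith)
    rw [mul_zero] at h0
    have h3 : Filter.Tendsto E₁ Filter.atTop (nhds 0) :=
      tendsto_of_tendsto_of_tendsto_of_le_of_le' tendsto_const_nhds h0
        (Filter.Eventually.of_forall hE₁)
        ((Filter.eventually_ge_atTop 1).mono fun t ht => hdec t ht)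
    have h4 := (Real.continuous_sqrt.tendsto 0).comp h3
    rwa [Real.sqrt_zero] at h4
  obtain ⟨t₁, ht₁1, hsmall⟩ : ∃ t₁ ≥ (1 : ℝ), ∀ t ≥ t₁, √(E₁ t) ≤ 1 ∧ 4 * K * √(E₁ t) ≤ β := by
    have hδ : 0 < min 1 (β / (4 * K)) := by positivity
    obtain ⟨T, hT⟩ := Filter.eventually_atTop.1 (hlim.eventually (gt_mem_nhds hδ))
    refine ⟨max 1 T, le_max_left _ _, fun t ht => ?_⟩
    have h := (hT t ((le_max_right _ _).trans ht)).le
    refine ⟨h.trans (min_le_left _ _), ?_⟩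
    have := h.trans (min_le_right _ _)
    rwa [le_div_iff₀ (by positivity), mul_comm] at this
  set Λ := 8 * K ^ 2 / β / η with hΛ
  have hΛ0 : 0 < Λ := by positivity
  set γ := min β η with hγ
  have hγ0 : 0 < γ := lt_min hβ hη
  have hΦ := le_exp_of_deriv_le (E := fun t => E₂ t + Λ * E₁ t) (D := fun t => D₂ t + Λ * D₁ t)
    (γ := γ) (t₁ := t₁) (fun t ht => (hd₂ t (by linarith)).fun_add ((hd₁ t (by linarith)).const_mul Λ))
    (fun t ht => by
      have hs := hsmall t ht
      have g1 := h₁ t (by linarith)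
      have g2 := h₂ t (by linarith)
      have q1 := Real.sq_sqrt (hE₁ t)
      have q2 := Real.sq_sqrt (hE₂ t)
      have p1 := Real.sqrt_nonneg (E₁ t)
      have p2 := Real.sqrt_nonneg (E₂ t)
      set x := √(E₁ t)
      set y := √(E₂ t)
      rw [← q1] at g1
      rw [← q2] at g2
      rw [← q1, ← q2]
      have i1 : 2 * (K * (1 + x + y) * (x * y)) ≤ 4 * K * (x * y) + (β / 2) * y ^ 2 := by
        have j1 : K * (x * (x * y)) ≤ K * (1 * (x * y)) := by
          have := hs.1
          gcongr
        have j2 : 4 * K * x * y ^ 2 ≤ β * y ^ 2 := by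
          have := hs.2
          gcongr
        linarith
      have i2 : 4 * K * (x * y) ≤ (β / 2) * y ^ 2 + 8 * K ^ 2 / β * x ^ 2 := by
        have : (β / 2) * y ^ 2 + 8 * K ^ 2 / β * x ^ 2 - 4 * K * (x * y)
            = (β * y - 4 * K * x) ^ 2 / (2 * β) := by
          field_simp; ring
        have : 0 ≤ (β * y - 4 * K * x) ^ 2 / (2 * β) := by positivity
        linarith
      have i3 : 8 * K ^ 2 / β = Λ * η := by rw [hΛ]; field_simp
      rw [i3] at i2
      have i4 : γ * y ^ 2 ≤ β * y ^ 2 := by gcongr; exact min_le_left _ _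
      have i5 : γ * (Λ * x ^ 2) ≤ η * (Λ * x ^ 2) := by gcongr; exact min_le_right _ _
      have i6 : Λ * D₁ t ≤ Λ * (-(2 * η) * x ^ 2) := by gcongr
      linarith)
  set Φ := E₂ t₁ + Λ * E₁ t₁ with hΦdef
  have hΦ0 : 0 ≤ Φ := add_nonneg (hE₂ _) (mul_nonneg hΛ0.le (hE₁ _))
  set A := 2 * (1 + 1 / Λ) * (Φ * Real.exp (γ * t₁)) with hA
  have hA0 : 0 ≤ A := by positivity
  refine ⟨√(A * (2 / γ ^ 2)) + 1, by positivity, t₁, ht₁1, fun t ht => ?_⟩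
  have ht1 : 1 ≤ t := ht₁1.trans ht
  have ht0 : 0 < t := by linarith
  have hsq : (√(E₁ t) + √(E₂ t)) ^ 2 ≤ A * Real.exp (-(γ * t)) := by
    have e : Real.exp (-γ * (t - t₁)) = Real.exp (γ * t₁) * Real.exp (-(γ * t)) := by
      rw [← Real.exp_add]; ring_nf
    have h := hΦ t ht
    simp only [e] at h
    have q1 := Real.sq_sqrt (hE₁ t)
    have q2 := Real.sq_sqrt (hE₂ t)
    calc (√(E₁ t) + √(E₂ t)) ^ 2 ≤ 2 * (E₁ t + E₂ t) := by
          nlinarith [sq_nonneg (√(E₁ t) - √(E₂ t))]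
      _ ≤ 2 * ((1 + 1 / Λ) * (E₂ t + Λ * E₁ t)) := by
          have : (1 + 1 / Λ) * (E₂ t + Λ * E₁ t) = E₁ t + E₂ t + (Λ * E₁ t + E₂ t / Λ) := by
            field_simp; ring
          have : 0 ≤ Λ * E₁ t + E₂ t / Λ :=
            add_nonneg (mul_nonneg hΛ0.le (hE₁ t)) (div_nonneg (hE₂ t) hΛ0.le)
          linarith
      _ ≤ 2 * ((1 + 1 / Λ) * (Φ * (Real.exp (γ * t₁) * Real.exp (-(γ * t))))) := by gcongr
      _ = A * Real.exp (-(γ * t)) := by rw [hA]; ring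
  have hexp : Real.exp (-(γ * t)) ≤ 2 / γ ^ 2 * (t ^ (-(3 : ℝ) / 4)) ^ 2 := by
    have h1 : (γ * t) ^ 2 / 2 ≤ Real.exp (γ * t) := by
      have := Real.quadratic_le_exp_of_nonneg (x := γ * t) (by positivity)
      nlinarith [mul_pos hγ0 ht0]
    have h2 : (t ^ 2)⁻¹ ≤ (t ^ (-(3 : ℝ) / 4)) ^ 2 := by
      rw [← Real.rpow_natCast, ← Real.rpow_natCast, ← Real.rpow_mul ht0.le, ← Real.rpow_neg ht0.le]
      exact Real.rpow_le_rpow_of_exponent_le ht1 (by norm_num)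
    rw [Real.exp_neg]
    calc (Real.exp (γ * t))⁻¹ ≤ ((γ * t) ^ 2 / 2)⁻¹ := by gcongr
      _ = 2 / γ ^ 2 * (t ^ 2)⁻¹ := by field_simp
      _ ≤ _ := by gcongr
  have hr : 0 ≤ t ^ (-(3 : ℝ) / 4) := Real.rpow_nonneg ht0.le _
  have h5 : √(E₁ t) + √(E₂ t) ≤ √(A * (2 / γ ^ 2)) * t ^ (-(3 : ℝ) / 4) := by
    refine le_of_sq_le_sq ?_ (by positivity)
    rw [mul_pow, Real.sq_sqrt (by positivity)]
    calc _ ≤ A * Real.exp (-(γ * t)) := hsq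
      _ ≤ A * (2 / γ ^ 2 * (t ^ (-(3 : ℝ) / 4)) ^ 2) := by gcongr
      _ = _ := by ring
  nlinarith

/-- Decay of perturbations of a stationary solution. -/
lemma exists_perturbation_decay {α β ν η c : ℝ} (hα : 0 < α) (hβ : 0 < β) (hν : 0 < ν) (hη : 0 < η)
    (U : Fin 3 → SR) (hU : ∑ j, dS j (U j) = 0)
    (htri : ∀ w : Fin 3 → SR, |∑ i, ip (∑ j, mulS (w j) (dS j (U i))) (w i)| ≤ c * hip α w w)
    (hc : c + η ≤ β) (w M r : Fin 3 → ℝ → SR) (q : ℝ → SR)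
    (hw : ∀ i, Fam (w i)) (hMF : ∀ i, Fam (M i)) (hq : Fam q)
    (hdiv : ∀ t > 0, ∑ j, dS j (w j t) = 0)
    (hM : ∀ t > 0, ∀ i, M i t - α ^ 2 • lap (M i t) = convection U (fun i => w i t) i)
    (hr : ∀ i t, r i t = ν • lap (w i t) + (-1 : ℝ) • M i t + (-1 : ℝ) • dS i (q t)
      + (-β) • w i t)
    (htd : ∀ i, TD (w i) (r i)) :
    ∃ C > 0, ∃ t₁ ≥ (1 : ℝ), ∀ t ≥ t₁, ∀ i x, |w i t x| ≤ C * t ^ (-(3 : ℝ) / 4) := by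
  have hrF : ∀ i, Fam (r i) := fun i => by
    rw [show r i = _ from funext (hr i)]
    exact ((((hw i).lap.smul ν).add ((hMF i).smul (-1))).add ((hq.dS i).smul (-1))).add
      ((hw i).smul (-β))
  obtain ⟨K, hK, hconv⟩ := exists_convection_lap_le hα U
  obtain ⟨S, hS, hsup⟩ := exists_sup_le hα
  obtain ⟨C, hC, t₁, ht₁, h⟩ := exists_decay_of_energy
    (E₁ := fun t => hip α (fun i => w i t) fun i => w i t)
    (E₂ := fun t => hip2 α (fun i => w i t) fun i => w i t) hη hβ hK
    (fun t => hip_self_nonneg _ _) (fun t => hip2_self_nonneg _ _)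
    (fun t ht => TD.hasDerivAt_hip htd hw hrF α ht) (fun t ht => TD.hasDerivAt_hip2 htd hw hrF α ht)
    (fun t ht => by
      have h := hip_rhs_le hν (fun i => w i t) (fun i => M i t) _ (fun i => r i t) (q t)
        (hdiv t ht) (hM t ht) (fun i => hr i t)
      rw [sum_ip_convection U _ hU (hdiv t ht)] at h
      have h1 := (abs_le.1 (htri fun i => w i t)).1
      have h2 := mul_le_mul_of_nonneg_right hc (hip_self_nonneg α fun i => w i t)
      linarith)
    (fun t ht => by
      have h := hip2_rhs_le hν (fun i => w i t) (fun i => M i t) _ (fun i => r i t) (q t)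
        (hdiv t ht) (hM t ht) (fun i => hr i t)
      have h1 := hconv fun i => w i t
      linarith)
  refine ⟨S * C, by positivity, t₁, ht₁, fun t ht i x => ?_⟩
  refine (hsup (fun i => w i t) i x).trans ?_
  rw [mul_assoc]
  exact mul_le_mul_of_nonneg_left (h t ht) hS.le

/-! ## Components of classical solutions -/

section Bundling

variable {F : Type*} [NormedAddCommGroup F] [NormedSpace ℝ F]

open Classical in
/-- The bundled Schwartz function of a function that satisfies `IsSchwartz`. -/
def toSchwartz (g : V3 → F) : SchwartzMap V3 F :=
  if h : IsSchwartz g then ⟨g, h.1, h.2⟩ else 0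

lemma coe_toSchwartz {g : V3 → F} (h : IsSchwartz g) : ⇑(toSchwartz g) = g := by
  rw [toSchwartz, dif_pos h]; rfl

lemma SchwartzLocBdd.isSchwartz {g : ℝ → V3 → F} (h : SchwartzLocBdd g) {t : ℝ} (ht : 0 < t) :
    IsSchwartz (g t) := by
  refine ⟨?_, fun k n => ?_⟩
  · have h1 : ContDiffOn ℝ (⊤ : ℕ∞) ((fun q : ℝ × V3 => g q.1 q.2) ∘ fun x => (t, x)) univ :=
      h.1.comp (contDiff_prodMk_right t).contDiffOn fun x _ => ⟨ht.le, mem_univ _⟩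
    exact contDiffOn_univ.1 h1
  · obtain ⟨C, hC⟩ := h.2 t ht k n
    exact ⟨C, hC t ⟨ht.le, le_rfl⟩⟩

lemma SchwartzLocBdd.isVonNBounded {g : ℝ → V3 → F} (h : SchwartzLocBdd g) (T : ℝ) :
    Bornology.IsVonNBounded ℝ ((fun t => toSchwartz (g t)) '' Ioo (0 : ℝ) T) := by
  rw [(schwartz_withSeminorms ℝ V3 F).image_isVonNBounded_iff_seminorm_bounded]
  rintro ⟨k, n⟩
  rcases le_or_gt T 0 with hT | hT
  · exact ⟨1, one_pos, fun t ht => absurd (ht.1.trans ht.2) hT.not_gt⟩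
  obtain ⟨C, hC⟩ := h.2 T hT k n
  refine ⟨max C 0 + 1, by positivity, fun t ht => lt_of_le_of_lt ?_ (lt_add_one _)⟩
  refine SchwartzMap.seminorm_le_bound ℝ k n _ (le_max_right _ _) fun x => ?_
  rw [coe_toSchwartz (h.isSchwartz ht.1)]
  exact (hC t ⟨ht.1.le, ht.2.le⟩ x).trans (le_max_left _ _)

end Bundling

lemma Fam.of_schwartzLocBdd {g : ℝ → V3 → ℝ} (h : SchwartzLocBdd g) :
    Fam fun t => toSchwartz (g t) where
  smooth := (h.1.mono (prod_mono Ioi_subset_Ici_self subset_rfl)).congr fun q hq => by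
    rw [coe_toSchwartz (h.isSchwartz hq.1)]
  bdd := h.isVonNBounded

/-- The `i`-th component of a vector field, as a Schwartz function. -/
def component (i : Fin 3) (g : V3 → Fin 3 → ℝ) : SR :=
  SchwartzMap.postcompCLM (ContinuousLinearMap.proj (R := ℝ) (φ := fun _ : Fin 3 => ℝ) i)
    (toSchwartz g)

lemma component_apply {g : V3 → Fin 3 → ℝ} (h : IsSchwartz g) (i : Fin 3) (x : V3) :
    component i g x = g x i := by
  change toSchwartz g x i = _
  rw [coe_toSchwartz h]

lemma eq_component {g : V3 → Fin 3 → ℝ} (h : IsSchwartz g) : g = fun x i => component i g x := by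
  ext x i; rw [component_apply h]

lemma Fam.component {g : ℝ → V3 → Fin 3 → ℝ} (h : SchwartzLocBdd g) (i : Fin 3) :
    Fam fun t => component i (g t) where
  smooth := by
    refine ContDiffOn.congr (contDiffOn_pi.1
      (h.1.mono (prod_mono Ioi_subset_Ici_self subset_rfl)) i) fun q hq => ?_
    rw [component_apply (h.isSchwartz hq.1)]
  bdd T := by
    have := (h.isVonNBounded T).image (SchwartzMap.postcompCLM
      (ContinuousLinearMap.proj (R := ℝ) (φ := fun _ : Fin 3 => ℝ) i) :
        SchwartzMap V3 (Fin 3 → ℝ) →L[ℝ] SR)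
    rwa [image_image] at this

lemma pd_pi (G : Fin 3 → SR) (j : Fin 3) :
    pd j (fun x i => G i x) = fun x i => dS j (G i) x := by
  ext x i
  have h : HasFDerivAt (fun x i => G i x) (ContinuousLinearMap.pi fun i => fderiv ℝ (G i) x) x :=
    hasFDerivAt_pi.2 fun i => (G i).differentiableAt.hasFDerivAt
  rw [pd, h.fderiv]
  rfl

lemma hip_component {f : V3 → Fin 3 → ℝ} (hf : IsSchwartz f) (α : ℝ) :
    hip α (fun i => component i f) (fun i => component i f) = H1aSq α f := by
  have h : ∀ G : Fin 3 → SR, H1aSq α (fun x i => G i x) = hip α G G := fun G => by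
    rw [H1aSq, L2sq, H1sq, integral_finsetSum _ fun i _ => by
        simpa [sq] using integrable_mul (G i) (G i),
      integral_finsetSum _ fun i _ => integrable_finsetSum _ fun j _ => by
        simpa [sq, pd_pi] using integrable_mul (dS j (G i)) (dS j (G i))]
    rw [hip, Finset.sum_add_distrib, Finset.mul_sum]
    congr 1
    · exact Finset.sum_congr rfl fun i _ => by simp [ip, sq]
    · refine Finset.sum_congr rfl fun i _ => ?_
      rw [integral_finsetSum _ fun j _ => by
        simpa [sq, pd_pi] using integrable_mul (dS j (G i)) (dS j (G i))]
      simp [ip, sq, pd_pi]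
  rw [← h, ← eq_component hf]

lemma sum_dS_component_eq_zero {g : V3 → Fin 3 → ℝ} (hg : IsSchwartz g)
    (h : ∀ x, (∑ j, pd j g x j) = 0) : ∑ j, dS j (component j g) = 0 := by
  ext x
  have := h x
  rw [eq_component hg] at this
  simp only [pd_pi] at this
  simpa using this

lemma filter_component {g N : V3 → Fin 3 → ℝ} (hg : IsSchwartz g) (hN : IsSchwartz N) {α : ℝ}
    (h : ∀ x i, -α ^ 2 * (∑ j, pd j (pd j N) x i) + N x i = ∑ j, g x j * pd j g x i) (i : Fin 3) :
    component i N - α ^ 2 • lap (component i N) = ∑ j, mulS (component j g) (dS j (component i g)) := by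
  ext x
  have := h x i
  rw [eq_component hg, eq_component hN] at this
  simp only [pd_pi] at this
  simp only [lap_apply, _root_.sub_apply, _root_.smul_apply, _root_.sum_apply,
    mulS_apply, smul_eq_mul]
  linarith

lemma sum_pd_pd_component {g : V3 → Fin 3 → ℝ} (hg : IsSchwartz g) (x : V3) (i : Fin 3) :
    ∑ j, pd j (pd j g) x i = lap (component i g) x := by
  conv_lhs => rw [eq_component hg]
  simp [pd_pi, lap_apply]

lemma pdS_eq {p : V3 → ℝ} (hp : IsSchwartz p) (i : Fin 3) (x : V3) :
    pdS i p x = dS i (toSchwartz p) x := by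
  rw [dS_apply, coe_toSchwartz hp, pdS]

lemma rpow_five_halves {α : ℝ} (hα : 0 < α) : α ^ ((5 : ℝ) / 2) = α ^ 2 * √α := by
  rw [Real.sqrt_eq_rpow, ← Real.rpow_natCast, ← Real.rpow_add hα]
  norm_num

lemma convection_sub (U u : Fin 3 → SR) (i : Fin 3) :
    convection U (fun i => u i - U i) i
      = ∑ j, mulS (u j) (dS j (u i)) - ∑ j, mulS (U j) (dS j (U i)) := by
  rw [convection, ← Finset.sum_sub_distrib]
  refine Finset.sum_congr rfl fun j _ => ?_
  ext x
  simp only [map_sub, mulS_apply, _root_.add_apply, _root_.sub_apply]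
  ring

/-- Asymptotic profile: solutions converge to the stationary solution at rate `t^(-3/4)`. -/
theorem asymptotic_profile :
    ∃ c : ℝ, 0 < c ∧
    ∀ (α β ν : ℝ), 0 < α → 0 < β → 0 < ν →
    ∀ (f : V3 → Fin 3 → ℝ), IsForce f →
      c / (α ^ ((5:ℝ)/2) * β) * Real.sqrt (H1aSq α f) < β →
    ∀ (S : StationarySolution α β ν f)
      (u₀ : V3 → Fin 3 → ℝ) (sol : ClassicalSolution α β ν u₀ f),
      ∃ C > (0:ℝ), ∃ t₀ ≥ (1:ℝ), ∀ t ≥ t₀, ∀ x : V3,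
        Real.sqrt (∑ i, (sol.u t x i - S.U x i)^2) ≤ C * t ^ (-(3:ℝ)/4) := by
  obtain ⟨c, hc, htri⟩ := exists_trilinear_le
  refine ⟨c, hc, fun α β ν hα hβ hν f hf hsmall S u₀ sol => ?_⟩
  let U : Fin 3 → SR := fun i => component i S.U
  have hsU := S.schwartz_U
  have hsN := S.schwartz_N
  have hsP := S.schwartz_P
  have hU : ∑ j, dS j (U j) = 0 := sum_dS_component_eq_zero hsU S.divFree
  have hNU := filter_component hsU hsN S.filter
  have hstat : ∀ i x, ν * lap (U i) x - component i S.N x - dS i (toSchwartz S.P) x - β * U i x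
      = -f x i := fun i x => by
    have h := S.momentum x i
    rw [sum_pd_pd_component hsU, pdS_eq hsP, ← component_apply hsN, ← component_apply hsU] at h
    linarith
  have hbound : β * √(hip α U U) ≤ √(H1aSq α f) := by
    rw [← hip_component hf.1]
    refine sqrt_hip_le_of_stationary hν U (fun i => component i S.N) (fun i => component i f)
      (toSchwartz S.P) hU hNU fun i => ?_
    ext x
    simp only [_root_.add_apply, _root_.smul_apply, _root_.neg_apply, smul_eq_mul,
      component_apply hf.1, ← hstat i x]
    ring
  set κ := c / (α ^ ((5 : ℝ) / 2) * β) * √(H1aSq α f) with hκ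
  have htri' : ∀ w : Fin 3 → SR, |∑ i, ip (∑ j, mulS (w j) (dS j (U i))) (w i)|
      ≤ κ * hip α w w := fun w => by
    have h := htri α hα U w
    have hs : 0 < α ^ 2 * √α := by positivity
    have hE := hip_self_nonneg α w
    have h1 : c * √(hip α U U) ≤ α ^ 2 * √α * κ := by
      have : α ^ 2 * √α * κ = c * (√(H1aSq α f) / β) := by
        rw [hκ, rpow_five_halves hα]; field_simp
      rw [this]
      gcongr
      rwa [le_div_iff₀ hβ, mul_comm]
    refine le_of_mul_le_mul_left (h.trans ?_) hs
    rw [← mul_assoc]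
    gcongr
  have hwF : ∀ i, Fam fun t => component i (sol.u t) - U i := fun i =>
    (Fam.component sol.reg_u i).sub (Fam.const _)
  have hMF : ∀ i, Fam fun t => component i (sol.N t) - component i S.N := fun i =>
    (Fam.component sol.reg_N i).sub (Fam.const _)
  have hqF : Fam fun t => toSchwartz (sol.p t) - toSchwartz S.P :=
    (Fam.of_schwartzLocBdd sol.reg_p).sub (Fam.const _)
  obtain ⟨C, hC, t₁, ht₁, h⟩ := exists_perturbation_decay (η := β - κ) hα hβ hν (sub_pos.2 hsmall)
    U hU htri' (by linarith) (fun i t => component i (sol.u t) - U i)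
    (fun i t => component i (sol.N t) - component i S.N) _
    (fun t => toSchwartz (sol.p t) - toSchwartz S.P) hwF hMF hqF
    (fun t ht => by
      have := sum_dS_component_eq_zero (sol.reg_u.isSchwartz ht) (sol.divFree t ht.le)
      simp only [map_sub, Finset.sum_sub_distrib, this, hU, sub_zero])
    (fun t ht i => by
      have := filter_component (sol.reg_u.isSchwartz ht) (sol.reg_N.isSchwartz ht)
        (sol.filter t ht.le) i
      rw [convection_sub U fun i => component i (sol.u t), ← this, ← hNU, map_sub, smul_sub]
      abel)
    (fun _ _ => rfl)
    (fun i t ht x => by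
      have hut := sol.reg_u.isSchwartz ht
      have hNt := sol.reg_N.isSchwartz ht
      have hpt := sol.reg_p.isSchwartz ht
      have hd : DifferentiableAt ℝ (fun s => component i (sol.u s) x) t :=
        (Fam.component sol.reg_u i).hasDerivAt ht x |>.differentiableAt
      have hev : (fun s => component i (sol.u s) x) =ᶠ[nhds t] fun s => sol.u s x i := by
        filter_upwards [lt_mem_nhds ht] with s hs
        exact component_apply (sol.reg_u.isSchwartz hs) i x
      have h := sol.momentum t ht.le x i
      rw [derivWithin_of_mem_nhds (Ici_mem_nhds ht), ← hev.deriv_eq, sum_pd_pd_component hut,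
        pdS_eq hpt, ← component_apply hNt, ← component_apply hut] at h
      have h2 := hstat i x
      refine (hd.hasDerivAt.sub_const (U i x)).congr_deriv ?_
      simp only [map_sub, _root_.add_apply, _root_.sub_apply, _root_.smul_apply, smul_eq_mul]
      linarith)
  refine ⟨2 * C, by positivity, t₁, ht₁, fun t ht x => ?_⟩
  have ht0 : 0 < t := by linarith
  have hr : 0 ≤ t ^ (-(3 : ℝ) / 4) := Real.rpow_nonneg ht0.le _
  have hi : ∀ i, (sol.u t x i - S.U x i) ^ 2 ≤ (C * t ^ (-(3 : ℝ) / 4)) ^ 2 := fun i => by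
    rw [← component_apply (sol.reg_u.isSchwartz ht0), ← component_apply hsU, ← sq_abs]
    exact pow_le_pow_left₀ (abs_nonneg _) (h t ht i x) 2
  refine Real.sqrt_le_iff.2 ⟨by positivity, (Finset.sum_le_sum fun i _ => hi i).trans ?_⟩
  rw [Finset.sum_const, Finset.card_univ, Fintype.card_fin]
  simp only [nsmul_eq_mul, Nat.cast_ofNat]
  nlinarith [sq_nonneg (C * t ^ (-(3 : ℝ) / 4))]

end
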